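/- arXiv:2008.05679 — 7 statements merged into one kernel-verified Lean document; each statement's English description precedes it below -/
import Mathlib

section
/- Let T : K → K be a Borel map satisfying d(T z₁, T z₂) ≤ α·d(z₁,z₂) for all z₁,z₂ ∈ K, where 0<α<1. Then for every finite Borel signed measure μ on K with μ(K)=0 one has ‖T_*μ‖_W ≤ α^ζ · ‖μ‖_W, where T_*μ denotes the pushforward of μ under T. -/
open MeasureTheory

/-- Integral of a function against a signed measure, via the Jordan decomposition. -/
noncomputable def sInt {X : Type*} [MeasurableSpace X] (μ : SignedMeasure X) (g : X → ℝ) : ℝ :=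
  ∫ x, g x ∂μ.toJordanDecomposition.posPart - ∫ x, g x ∂μ.toJordanDecomposition.negPart

/-- The Wasserstein–Kantorovich-like norm `‖μ‖_W`. -/
noncomputable def wNorm {X : Type*} [MetricSpace X] [MeasurableSpace X] (ζ : ℝ)
    (μ : SignedMeasure X) : ℝ :=
  sSup {r | ∃ g : X → ℝ, (∀ x, |g x| ≤ 1) ∧ (∀ x y, |g x - g y| ≤ dist x y ^ ζ) ∧
    r = |sInt μ g|}

theorem aux_apply {X : Type*} [MeasurableSpace X] (μ : SignedMeasure X) {s : Set X}
    (hs : MeasurableSet s) : μ s = μ.toJordanDecomposition.posPart.real s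
      - μ.toJordanDecomposition.negPart.real s := by
  conv_lhs => rw [← SignedMeasure.toSignedMeasure_toJordanDecomposition μ]
  simp [JordanDecomposition.toSignedMeasure, Measure.toSignedMeasure_apply_measurable hs]

theorem aux_sInt {X : Type*} [MeasurableSpace X] (μ : SignedMeasure X) (P N : Measure X)
    [IsFiniteMeasure P] [IsFiniteMeasure N]
    (h : ∀ s, MeasurableSet s → μ s = P.real s - N.real s) (g : X → ℝ) (hg : Measurable g)
    (hb : ∀ x, |g x| ≤ 1) : sInt μ g = ∫ x, g x ∂P - ∫ x, g x ∂N := by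
  have hint : ∀ (ν : Measure X) [IsFiniteMeasure ν], Integrable g ν := fun ν _ =>
    Integrable.of_bound hg.aestronglyMeasurable 1 (Filter.Eventually.of_forall hb)
  have key : μ.toJordanDecomposition.posPart + N = μ.toJordanDecomposition.negPart + P := by
    ext s hs
    rw [← measureReal_eq_measureReal_iff, measureReal_add_apply, measureReal_add_apply]
    have := aux_apply μ hs
    have := h s hs
    linarith
  have h2 : ∫ x, g x ∂(μ.toJordanDecomposition.posPart + N)
      = ∫ x, g x ∂(μ.toJordanDecomposition.negPart + P) := by rw [key]
  rw [integral_add_measure (hint _) (hint _), integral_add_measure (hint _) (hint _)] at h2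
  unfold sInt
  linarith

theorem aux_meas {X : Type*} [MetricSpace X] [MeasurableSpace X] [BorelSpace X] {ζ : ℝ}
    (hζ : 0 < ζ) (g : X → ℝ) (hg : ∀ x y, |g x - g y| ≤ dist x y ^ ζ) : Measurable g := by
  apply Continuous.measurable
  rw [continuous_iff_continuousAt]
  intro x
  rw [ContinuousAt, tendsto_iff_dist_tendsto_zero]
  refine squeeze_zero (fun _ => dist_nonneg) (fun y => hg y x) ?_
  have : Continuous fun y => dist y x ^ ζ :=
    (continuous_id.dist continuous_const).rpow_const (fun _ => Or.inr hζ.le)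
  simpa [Real.zero_rpow hζ.ne'] using this.tendsto x

theorem aux_bdd {X : Type*} [MetricSpace X] [MeasurableSpace X] (ζ : ℝ)
    (μ : SignedMeasure X) : BddAbove {r | ∃ g : X → ℝ, (∀ x, |g x| ≤ 1) ∧
      (∀ x y, |g x - g y| ≤ dist x y ^ ζ) ∧ r = |sInt μ g|} := by
  refine ⟨μ.toJordanDecomposition.posPart.real Set.univ
      + μ.toJordanDecomposition.negPart.real Set.univ, ?_⟩
  rintro _ ⟨g, hb, -, rfl⟩
  have hn : ∀ (ν : Measure X) [IsFiniteMeasure ν], |∫ x, g x ∂ν| ≤ ν.real Set.univ := by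
    intro ν _
    simpa using norm_integral_le_of_norm_le_const (μ := ν) (f := g) (C := 1)
      (Filter.Eventually.of_forall hb)
  exact (abs_sub _ _).trans (add_le_add (hn _) (hn _))

/-- If `T : K → K` is a Borel `α`-contraction (`0 < α < 1`) on a compact metric
space of diameter at most `1`, then for every finite Borel signed measure `μ` on `K` with
`μ(K) = 0` one has `‖T_*μ‖_W ≤ α^ζ · ‖μ‖_W`. -/
theorem pushforward_contraction_wNorm {K : Type*} [MetricSpace K] [CompactSpace K]
    [MeasurableSpace K] [BorelSpace K]
    (hdiam : Metric.diam (Set.univ : Set K) ≤ 1)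
    (ζ α : ℝ) (hζ0 : 0 < ζ) (hζ1 : ζ ≤ 1) (hα0 : 0 < α) (hα1 : α < 1)
    (T : K → K) (hT : Measurable T)
    (hTc : ∀ z₁ z₂ : K, dist (T z₁) (T z₂) ≤ α * dist z₁ z₂)
    (μ : SignedMeasure K) (hμ : μ Set.univ = 0) :
    wNorm ζ (μ.map T) ≤ α ^ ζ * wNorm ζ μ := by
  have hα : 0 < α ^ ζ := Real.rpow_pos_of_pos hα0 ζ
  have hW : 0 ≤ wNorm ζ μ := by
    apply Real.sSup_nonneg
    rintro _ ⟨g, -, -, rfl⟩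
    exact abs_nonneg _
  apply csSup_le
  · exact ⟨_, fun _ => 0, by simp, fun x y => by simpa using Real.rpow_nonneg dist_nonneg ζ, rfl⟩
  rintro _ ⟨g, hb, hL, rfl⟩
  rcases isEmpty_or_nonempty K with hK | ⟨⟨x0⟩⟩
  · have : sInt (μ.map T) g = 0 := by
      simp [sInt, Measure.eq_zero_of_isEmpty]
    rw [this, abs_zero]
    positivity
  have hgm := aux_meas hζ0 g hL
  set P := μ.toJordanDecomposition.posPart with hP
  set N := μ.toJordanDecomposition.negPart with hN
  have h1 : sInt (μ.map T) g = ∫ x, g (T x) ∂P - ∫ x, g (T x) ∂N := by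
    rw [aux_sInt (μ.map T) (P.map T) (N.map T) _ g hgm hb,
      integral_map hT.aemeasurable hgm.aestronglyMeasurable,
      integral_map hT.aemeasurable hgm.aestronglyMeasurable]
    intro s hs
    rw [VectorMeasure.map_apply _ hT hs, aux_apply μ (hT hs),
      map_measureReal_apply hT hs, map_measureReal_apply hT hs]
  have hL' : ∀ x y, |g (T x) - g (T y)| ≤ α ^ ζ * dist x y ^ ζ := fun x y => by
    rw [← Real.mul_rpow hα0.le dist_nonneg]
    exact (hL _ _).trans (Real.rpow_le_rpow dist_nonneg (hTc x y) hζ0.le)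
  let h : K → ℝ := fun x => (α ^ ζ)⁻¹ * (g (T x) - g (T x0))
  have hhL : ∀ x y, |h x - h y| ≤ dist x y ^ ζ := fun x y => by
    have : h x - h y = (α ^ ζ)⁻¹ * (g (T x) - g (T y)) := by simp only [h]; ring
    rw [this, abs_mul, abs_of_pos (inv_pos.2 hα), inv_mul_le_iff₀ hα]
    exact hL' x y
  have hhb : ∀ x, |h x| ≤ 1 := fun x => by
    have h3 := hhL x x0
    have : h x0 = 0 := by simp [h]
    rw [this, sub_zero] at h3
    refine h3.trans (Real.rpow_le_one dist_nonneg ?_ hζ0.le)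
    exact (Metric.dist_le_diam_of_mem isCompact_univ.isBounded (Set.mem_univ _)
      (Set.mem_univ _)).trans hdiam
  have hint : ∀ (ν : Measure K) [IsFiniteMeasure ν], Integrable (fun x => g (T x)) ν := fun ν _ =>
    Integrable.of_bound (hgm.comp hT).aestronglyMeasurable 1
      (Filter.Eventually.of_forall fun x => hb _)
  have hmass : P.real Set.univ - N.real Set.univ = 0 := by
    rw [← aux_apply μ MeasurableSet.univ, hμ]
  have hI : ∀ (ν : Measure K) [IsFiniteMeasure ν], ∫ x, h x ∂ν
      = (α ^ ζ)⁻¹ * (∫ x, g (T x) ∂ν - ν.real Set.univ * g (T x0)) := by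
    intro ν _
    simp only [h]
    rw [integral_const_mul, integral_sub (hint ν) (integrable_const _), integral_const,
      smul_eq_mul]
  have h2 : sInt (μ.map T) g = α ^ ζ * sInt μ h := by
    rw [h1, sInt, hI, hI, ← mul_sub, ← mul_assoc, mul_inv_cancel₀ hα.ne']
    linear_combination g (T x0) * hmass
  rw [h2, abs_mul, abs_of_pos hα]
  exact mul_le_mul_of_nonneg_left (le_csSup (aux_bdd ζ μ) ⟨h, hhb, hhL, rfl⟩) hα.le
end

section
/- Let (M,d₁) be a metric space, x,y ∈ M, and let G(x,·), G(y,·) : K → K be Borel maps such that G(x,·) satisfies d(G(x,z₁),G(x,z₂)) ≤ α·d(z₁,z₂) for all z₁,z₂ ∈ K with 0<α<1, and sup_{z∈K} d(G(x,z),G(y,z)) ≤ ε. Then for any two Borel probability measures ν_x, ν_y on K one has ‖G(x,·)_*ν_x − G(y,·)_*ν_y‖_W ≤ α^ζ·‖ν_x − ν_y‖_W + ε^ζ. -/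
open MeasureTheory

/-- The Wasserstein–Kantorovich-like distance between two (positive) Borel measures:
`‖ν₁ − ν₂‖_W` computed with test functions `g` with `sup |g| ≤ 1` and
`|g x − g y| ≤ d(x,y)^ζ`. -/
noncomputable def wDist {K : Type*} [MetricSpace K] [MeasurableSpace K] (ζ : ℝ)
    (ν₁ ν₂ : Measure K) : ℝ :=
  sSup {r | ∃ g : K → ℝ, (∀ x, |g x| ≤ 1) ∧ (∀ x y, |g x - g y| ≤ dist x y ^ ζ) ∧
    r = |∫ x, g x ∂ν₁ - ∫ x, g x ∂ν₂|}

/-- Let `K` be a compact metric space of diameter at most `1`, `0 < ζ ≤ 1`,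
and let `M` be a metric space with `x, y ∈ M`. Suppose `G(x,·), G(y,·) : K → K` are Borel maps,
`G(x,·)` is an `α`-contraction (`0 < α < 1`), and `sup_z d(G(x,z), G(y,z)) ≤ ε`. Then for any
Borel probability measures `ν_x, ν_y` on `K`:
`‖G(x,·)_*ν_x − G(y,·)_*ν_y‖_W ≤ α^ζ·‖ν_x − ν_y‖_W + ε^ζ`. -/
theorem wDist_fiber_maps_le {M K : Type*} [MetricSpace M] [MetricSpace K] [CompactSpace K]
    [MeasurableSpace K] [BorelSpace K]
    (hdiam : Metric.diam (Set.univ : Set K) ≤ 1)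
    (ζ α ε : ℝ) (hζ0 : 0 < ζ) (hζ1 : ζ ≤ 1) (hα0 : 0 < α) (hα1 : α < 1) (hε : 0 ≤ ε)
    (x y : M) (G : M → K → K) (hGx : Measurable (G x)) (hGy : Measurable (G y))
    (hGc : ∀ z₁ z₂ : K, dist (G x z₁) (G x z₂) ≤ α * dist z₁ z₂)
    (hclose : ∀ z : K, dist (G x z) (G y z) ≤ ε)
    (νx νy : Measure K) [IsProbabilityMeasure νx] [IsProbabilityMeasure νy] :
    wDist ζ (νx.map (G x)) (νy.map (G y)) ≤ α ^ ζ * wDist ζ νx νy + ε ^ ζ := by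
  haveI : Nonempty K := by
    by_contra hne
    rw [not_nonempty_iff] at hne
    have h1 := measure_univ (μ := νx)
    rw [Set.univ_eq_empty_iff.mpr hne] at h1
    simp at h1
  obtain ⟨z0⟩ := this
  have hd : ∀ a b : K, dist a b ≤ 1 := fun a b =>
    (Metric.dist_le_diam_of_mem isCompact_univ.isBounded (Set.mem_univ a)
      (Set.mem_univ b)).trans hdiam
  have hcont : ∀ g : K → ℝ, (∀ x y, |g x - g y| ≤ dist x y ^ ζ) → Continuous g := by
    intro g hg
    rw [continuous_iff_continuousAt]
    intro a
    rw [ContinuousAt, tendsto_iff_dist_tendsto_zero]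
    have h1 : Filter.Tendsto (fun b : K => dist b a ^ ζ) (nhds a) (nhds 0) := by
      have h2 : Continuous (fun b : K => dist b a ^ ζ) :=
        (continuous_id.dist continuous_const).rpow_const (fun _ => Or.inr hζ0.le)
      have h3 := h2.tendsto a
      simpa [Real.zero_rpow hζ0.ne'] using h3
    exact squeeze_zero (fun _ => dist_nonneg) (fun b => by
      rw [Real.dist_eq]; exact hg b a) h1
  have hint : ∀ (μ : Measure K) [IsProbabilityMeasure μ] (f : K → ℝ), Measurable f →
      (∀ z, |f z| ≤ 1) → Integrable f μ := by
    intro μ _ f hf hb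
    exact Integrable.of_bound hf.aestronglyMeasurable 1 (Filter.Eventually.of_forall hb)
  have hint1 : ∀ (μ : Measure K) [IsProbabilityMeasure μ] (f : K → ℝ) (C : ℝ),
      (∀ z, |f z| ≤ C) → |∫ z, f z ∂μ| ≤ C := by
    intro μ _ f C hb
    have := norm_integral_le_of_norm_le_const (μ := μ) (f := f) (C := C)
      (Filter.Eventually.of_forall hb)
    simpa using this
  have hbdd : BddAbove {r | ∃ g : K → ℝ, (∀ x, |g x| ≤ 1) ∧
      (∀ x y, |g x - g y| ≤ dist x y ^ ζ) ∧ r = |∫ x, g x ∂νx - ∫ x, g x ∂νy|} := by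
    refine ⟨2, ?_⟩
    rintro r ⟨g, hg1, -, rfl⟩
    have h1 := hint1 νx g 1 hg1
    have h2 := hint1 νy g 1 hg1
    rw [abs_le] at *
    constructor <;> linarith
  have hαz : 0 < α ^ ζ := Real.rpow_pos_of_pos hα0 ζ
  unfold wDist
  apply csSup_le
  · exact ⟨_, fun _ => 0, by simp, fun a b => by simp; positivity, rfl⟩
  rintro r ⟨g, hg1, hg2, rfl⟩
  have hgc := hcont g hg2
  rw [integral_map hGx.aemeasurable hgc.aestronglyMeasurable,
    integral_map hGy.aemeasurable hgc.aestronglyMeasurable]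
  have hxx := hint νx (fun z => g (G x z)) (hgc.measurable.comp hGx) (fun z => hg1 _)
  have hxy := hint νy (fun z => g (G x z)) (hgc.measurable.comp hGx) (fun z => hg1 _)
  have hyy := hint νy (fun z => g (G y z)) (hgc.measurable.comp hGy) (fun z => hg1 _)
  have hB : |∫ z, g (G x z) ∂νy - ∫ z, g (G y z) ∂νy| ≤ ε ^ ζ := by
    rw [← integral_sub hxy hyy]
    exact hint1 νy _ _ (fun z => (hg2 _ _).trans
      (Real.rpow_le_rpow dist_nonneg (hclose z) hζ0.le))
  have hkey : ∀ a b, |g (G x a) - g (G x b)| ≤ α ^ ζ * dist a b ^ ζ := by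
    intro a b
    rw [← Real.mul_rpow hα0.le dist_nonneg]
    exact (hg2 _ _).trans (Real.rpow_le_rpow dist_nonneg (hGc a b) hζ0.le)
  have hL : ∀ a b, |(α ^ ζ)⁻¹ * (g (G x a) - g (G x b))| ≤ dist a b ^ ζ := by
    intro a b
    rw [abs_mul, abs_of_pos (inv_pos.mpr hαz), inv_mul_le_iff₀ hαz]
    exact hkey a b
  have hA : |∫ z, g (G x z) ∂νx - ∫ z, g (G x z) ∂νy| ≤ α ^ ζ *
      sSup {r | ∃ g : K → ℝ, (∀ x, |g x| ≤ 1) ∧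
      (∀ x y, |g x - g y| ≤ dist x y ^ ζ) ∧ r = |∫ x, g x ∂νx - ∫ x, g x ∂νy|} := by
    rw [← inv_mul_le_iff₀ hαz]
    apply le_csSup hbdd
    refine ⟨fun z => (α ^ ζ)⁻¹ * (g (G x z) - g (G x z0)), fun z => ?_, fun a b => ?_, ?_⟩
    · exact (hL z z0).trans (Real.rpow_le_one dist_nonneg (hd _ _) hζ0.le)
    · rw [← mul_sub, sub_sub_sub_cancel_right]
      exact hL a b
    · rw [integral_const_mul, integral_const_mul, integral_sub hxx (integrable_const _),
        integral_sub hxy (integrable_const _), ← mul_sub, abs_mul,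
        abs_of_pos (inv_pos.mpr hαz)]
      simp
  exact (abs_sub_le _ (∫ z, g (G x z) ∂νy) _).trans (add_le_add hA hB)
end

section
/- Suppose L₀ and L_δ are linear operators on a normed real vector space (B, ‖·‖_B), f₀, f_δ ∈ B satisfy L₀ f₀ = f₀ and L_δ f_δ = f_δ, the quantity ‖L_δ f_δ − L₀ f_δ‖_B is finite, and for each integer i ≥ 0 there is a constant C_i (with C₀ = 1) such that ‖L₀^i g‖_B ≤ C_i ‖g‖_B for all g ∈ B. Then for every integer N ≥ 1: ‖f_δ − f₀‖_B ≤ ‖L₀^N (f_δ − f₀)‖_B + ‖L_δ f_δ − L₀ f_δ‖_B · Σ_{i=0}^{N−1} C_i. -/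
/-- Abstract fixed-point stability lemma. If `L₀, L_δ` are linear operators on a
normed real vector space `B`, `f₀` and `f_δ` are respective fixed points, and the iterates of
`L₀` are bounded by constants `C i` (with `C 0 = 1`), then for every `N ≥ 1`:
`‖f_δ − f₀‖ ≤ ‖L₀^N (f_δ − f₀)‖ + ‖L_δ f_δ − L₀ f_δ‖ · Σ_{i=0}^{N−1} C i`. -/
theorem fixed_point_stability {B : Type*} [NormedAddCommGroup B] [Module ℝ B]
    (L₀ Lδ : B →ₗ[ℝ] B) (f₀ fδ : B)
    (hfix₀ : L₀ f₀ = f₀) (hfixδ : Lδ fδ = fδ)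
    (C : ℕ → ℝ) (hC0 : C 0 = 1)
    (hC : ∀ (i : ℕ) (g : B), ‖(L₀ ^ i) g‖ ≤ C i * ‖g‖) :
    ∀ N : ℕ, 1 ≤ N →
      ‖fδ - f₀‖ ≤ ‖(L₀ ^ N) (fδ - f₀)‖ + ‖Lδ fδ - L₀ fδ‖ * ∑ i ∈ Finset.range N, C i := by
  intro N _
  induction N with
  | zero => simp
  | succ n ih =>
    have ih' : ‖fδ - f₀‖ ≤ ‖(L₀ ^ n) (fδ - f₀)‖
        + ‖Lδ fδ - L₀ fδ‖ * ∑ i ∈ Finset.range n, C i := by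
      rcases Nat.eq_zero_or_pos n with h | h
      · subst h
        simp
      · exact ih h
    have key : (L₀ ^ n) (fδ - f₀)
        = (L₀ ^ (n + 1)) (fδ - f₀) + (L₀ ^ n) (Lδ fδ - L₀ fδ) := by
      rw [pow_succ, Module.End.mul_apply, ← map_add, map_sub L₀, hfix₀, hfixδ]
      congr 1
      abel
    have h1 := norm_add_le ((L₀ ^ (n + 1)) (fδ - f₀)) ((L₀ ^ n) (Lδ fδ - L₀ fδ))
    rw [← key] at h1
    have h2 := hC n (Lδ fδ - L₀ fδ)
    rw [Finset.sum_range_succ, mul_add]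
    linarith [mul_comm (C n) ‖Lδ fδ - L₀ fδ‖]
end

section
/- There exists a unique finite Borel measure μ₀ on Σ = M×K such that for every continuous function ψ : Σ → ℝ both limits lim_{n→∞} ∫_M ( inf_{(x,y) ∈ {γ}×K} ψ(F^n(x,y)) ) dm₁(γ) and lim_{n→∞} ∫_M ( sup_{(x,y) ∈ {γ}×K} ψ(F^n(x,y)) ) dm₁(γ) exist and are both equal to ∫_Σ ψ dμ₀. Moreover, μ₀ is F-invariant (F_*μ₀ = μ₀) and its first marginal is m₁ (π_{x*}μ₀ = m₁). -/
open MeasureTheory Filter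

lemma aux_meas_CK {M K : Type*} [MeasurableSpace M] [MetricSpace K] [CompactSpace K] [Nonempty K]
    (h : M → C(K, ℝ)) (hm : ∀ z, Measurable fun x => h x z) : StronglyMeasurable h := by
  borelize C(K, ℝ)
  apply Measurable.stronglyMeasurable
  have hd : ∀ g : C(K, ℝ), Measurable fun x => dist (h x) g := by
    intro g
    have : (fun x => dist (h x) g)
        = fun x => ⨆ i : ℕ, dist (h x (TopologicalSpace.denseSeq K i)) (g (TopologicalSpace.denseSeq K i)) := by
      ext x
      rw [ContinuousMap.dist_eq_iSup]
      have hb : BddAbove (Set.range fun z => dist (h x z) (g z)) :=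
        (isCompact_range (by fun_prop)).bddAbove
      apply le_antisymm
      · apply ciSup_le
        intro z
        have hcl : IsClosed {z : K | dist (h x z) (g z) ≤ ⨆ i : ℕ, dist (h x (TopologicalSpace.denseSeq K i)) (g (TopologicalSpace.denseSeq K i))} :=
          isClosed_le (by fun_prop) continuous_const
        have hb2 : BddAbove (Set.range fun i => dist (h x (TopologicalSpace.denseSeq K i)) (g (TopologicalSpace.denseSeq K i))) :=
          hb.mono (by rintro _ ⟨i, rfl⟩; exact ⟨_, rfl⟩)
        exact (TopologicalSpace.denseRange_denseSeq K).induction_on z hcl fun i => le_ciSup hb2 i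
      · exact ciSup_le fun i => le_ciSup hb _
    rw [this]
    exact Measurable.iSup fun i => (hm _).dist measurable_const
  have : borel C(K, ℝ) = MeasurableSpace.generateFrom {s | ∃ g : C(K, ℝ), ∃ r : ℝ, s = Metric.ball g r} := by
    apply TopologicalSpace.IsTopologicalBasis.borel_eq_generateFrom
    apply TopologicalSpace.isTopologicalBasis_of_isOpen_of_nhds
    · rintro _ ⟨g, r, rfl⟩; exact Metric.isOpen_ball
    · intro g u hg hu
      obtain ⟨r, hr, hru⟩ := Metric.isOpen_iff.1 hu g hg
      exact ⟨_, ⟨g, r, rfl⟩, Metric.mem_ball_self hr, hru⟩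
  rw [show (@Measurable M C(K, ℝ) _ (borel _) h) = (@Measurable M C(K, ℝ) _ (MeasurableSpace.generateFrom {s | ∃ g : C(K, ℝ), ∃ r : ℝ, s = Metric.ball g r}) h) by rw [this]]
  apply measurable_generateFrom
  rintro _ ⟨g, r, rfl⟩
  exact measurableSet_lt (hd g) measurable_const

lemma aux_meas_sup {M K : Type*} [MeasurableSpace M] [MetricSpace K] [CompactSpace K] [Nonempty K]
    (u : M → K → ℝ) (hc : ∀ x, Continuous (u x)) (hm : ∀ z, Measurable fun x => u x z) :
    Measurable fun x => ⨆ z, u x z := by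
  have : (fun x => ⨆ z, u x z) = fun x => ⨆ i : ℕ, u x (TopologicalSpace.denseSeq K i) := by
    ext x
    have hb : BddAbove (Set.range fun z => u x z) := (isCompact_range (hc x)).bddAbove
    apply le_antisymm
    · apply ciSup_le
      intro z
      have hcl : IsClosed {z : K | u x z ≤ ⨆ i : ℕ, u x (TopologicalSpace.denseSeq K i)} :=
        isClosed_le (hc x) continuous_const
      have hb2 : BddAbove (Set.range fun i => u x (TopologicalSpace.denseSeq K i)) :=
        hb.mono (by rintro _ ⟨i, rfl⟩; exact ⟨_, rfl⟩)
      exact (TopologicalSpace.denseRange_denseSeq K).induction_on z hcl fun i => le_ciSup hb2 i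
    · exact ciSup_le fun i => le_ciSup hb _
  rw [this]
  exact Measurable.iSup fun i => hm _

lemma aux_core {M K : Type*}
    [MetricSpace M] [CompactSpace M] [MeasurableSpace M] [BorelSpace M]
    [MetricSpace K] [CompactSpace K] [MeasurableSpace K] [BorelSpace K] [Nonempty K]
    (m₁ : Measure M) [IsProbabilityMeasure m₁]
    (f : M → M) (hf : Measurable f) (hfinv : m₁.map f = m₁)
    (G : M × K → K) (hG : Measurable G)
    (α : ℝ) (hα0 : 0 < α) (hα1 : α < 1)
    (hGc : ∀ x, ∀ z₁ z₂ : K, dist (G (x, z₁)) (G (x, z₂)) ≤ α * dist z₁ z₂)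
    (F : M × K → M × K) (hF : ∀ p, F p = (f p.1, G p)) :
    ∃ μ₀ : Measure (M × K), IsFiniteMeasure μ₀ ∧
      (∀ ψ : M × K → ℝ, Continuous ψ →
        Tendsto (fun n : ℕ => ∫ γ, (⨅ y : K, ψ (F^[n] (γ, y))) ∂m₁) atTop
          (nhds (∫ p, ψ p ∂μ₀)) ∧
        Tendsto (fun n : ℕ => ∫ γ, (⨆ y : K, ψ (F^[n] (γ, y))) ∂m₁) atTop
          (nhds (∫ p, ψ p ∂μ₀))) ∧
      μ₀.map F = μ₀ ∧ μ₀.map Prod.fst = m₁ := by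
  obtain ⟨y0⟩ := ‹Nonempty K›
  have : Nonempty K := ⟨y0⟩
  have hFm : Measurable F := by
    rw [show F = fun p => (f p.1, G p) from funext hF]; fun_prop
  have hFnm : ∀ n, Measurable F^[n] := fun n => hFm.iterate n
  have hfp : MeasurePreserving f m₁ m₁ := ⟨hf, hfinv⟩
  have hfn : ∀ n, MeasurePreserving f^[n] m₁ m₁ := fun n => hfp.iterate n
  have hfst : ∀ n p, (F^[n] p).1 = f^[n] p.1 := by
    intro n
    induction n with
    | zero => intro p; rfl
    | succ n ih => intro p; rw [Function.iterate_succ_apply, Function.iterate_succ_apply, ih, hF]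
  have hsnd : ∀ n γ z₁ z₂, dist (F^[n] (γ, z₁)).2 (F^[n] (γ, z₂)).2 ≤ α ^ n * dist z₁ z₂ := by
    intro n
    induction n with
    | zero => intro γ z₁ z₂; simp
    | succ n ih =>
      intro γ z₁ z₂
      rw [Function.iterate_succ_apply, Function.iterate_succ_apply, hF, hF]
      refine (ih _ _ _).trans ?_
      rw [pow_succ, mul_assoc]
      exact mul_le_mul_of_nonneg_left (hGc _ _ _) (by positivity)
  have hcont : ∀ n γ, Continuous fun z => F^[n] (γ, z) := by
    intro n γ
    have h2 : LipschitzWith (Real.toNNReal (α ^ n)) fun z => (F^[n] (γ, z)).2 := by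
      apply LipschitzWith.of_dist_le_mul
      intro z₁ z₂
      rw [Real.coe_toNNReal _ (by positivity)]
      exact hsnd n γ z₁ z₂
    have : (fun z => F^[n] (γ, z)) = fun z => (f^[n] γ, (F^[n] (γ, z)).2) := by
      ext z <;> simp [hfst]
    rw [this]
    exact continuous_const.prodMk h2.continuous
  -- oscillation
  have hosc : ∀ ψ : M × K → ℝ, Continuous ψ → ∀ ε > 0, ∃ N, ∀ n ≥ N, ∀ γ z₁ z₂,
      |ψ (F^[n] (γ, z₁)) - ψ (F^[n] (γ, z₂))| ≤ ε := by
    intro ψ hψ ε hε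
    obtain ⟨δ, hδ, H⟩ := Metric.uniformContinuous_iff.1
      (CompactSpace.uniformContinuous_of_continuous hψ) ε hε
    have ht : Tendsto (fun n : ℕ => α ^ n * Metric.diam (Set.univ : Set K)) atTop (nhds 0) := by
      simpa using (tendsto_pow_atTop_nhds_zero_of_lt_one hα0.le hα1).mul_const
        (Metric.diam (Set.univ : Set K))
    obtain ⟨N, hN⟩ := eventually_atTop.1 (ht.eventually_lt_const hδ)
    refine ⟨N, fun n hn γ z₁ z₂ => ?_⟩
    rw [← Real.dist_eq]
    refine (H ?_).le
    rw [Prod.dist_eq, hfst, hfst, dist_self]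
    refine max_lt hδ (lt_of_le_of_lt ((hsnd n γ z₁ z₂).trans ?_) (hN n hn))
    exact mul_le_mul_of_nonneg_left (Metric.dist_le_diam_of_mem
      (isCompact_univ.isBounded) trivial trivial) (by positivity)
  have hbd : ∀ ψ : M × K → ℝ, Continuous ψ → ∃ C, ∀ p, |ψ p| ≤ C := by
    intro ψ hψ
    obtain ⟨C, hC⟩ := isCompact_univ.exists_bound_of_continuousOn hψ.continuousOn
    exact ⟨C, fun p => hC p trivial⟩
  have hint : ∀ ψ : M × K → ℝ, Continuous ψ → ∀ n (w : M → K), Measurable w →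
      Integrable (fun γ => ψ (F^[n] (γ, w γ))) m₁ := by
    intro ψ hψ n w hw
    obtain ⟨C, hC⟩ := hbd ψ hψ
    refine Integrable.of_bound (C := C) ?_ (ae_of_all _ fun γ => hC _)
    exact (hψ.measurable.comp ((hFnm n).comp (by fun_prop))).aestronglyMeasurable
  have hclose : ∀ (u v : M → ℝ) (ε : ℝ), Integrable u m₁ → Integrable v m₁ → (∀ x, |u x - v x| ≤ ε) →
      |∫ x, u x ∂m₁ - ∫ x, v x ∂m₁| ≤ ε := by
    intro u v ε hu hv h
    rw [← integral_sub hu hv]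
    have := norm_integral_le_of_norm_le_const (μ := m₁) (f := fun x => u x - v x) (C := ε)
      (ae_of_all _ h)
    simpa using this
  -- Cauchy
  have hcau : ∀ ψ : M × K → ℝ, Continuous ψ →
      CauchySeq fun n : ℕ => ∫ γ, ψ (F^[n] (γ, y0)) ∂m₁ := by
    intro ψ hψ
    apply Metric.cauchySeq_iff'.2
    intro ε hε
    obtain ⟨N, hN⟩ := hosc ψ hψ (ε / 2) (by positivity)
    refine ⟨N, fun n hn => ?_⟩
    obtain ⟨k, rfl⟩ := Nat.exists_eq_add_of_le hn
    have e1 : ∫ γ, ψ (F^[N] (γ, y0)) ∂m₁ = ∫ γ, ψ (F^[N] (f^[k] γ, y0)) ∂m₁ := by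
      conv_lhs => rw [← (hfn k).map_eq]
      rw [integral_map (hfn k).measurable.aemeasurable]
      rw [(hfn k).map_eq]
      exact (hint ψ hψ N (fun _ => y0) measurable_const).aestronglyMeasurable
    rw [e1, Real.dist_eq]
    refine lt_of_le_of_lt (hclose _ _ (ε / 2) (hint ψ hψ _ (fun _ => y0) measurable_const) ?_ ?_)
      (half_lt_self hε)
    · exact (hfn k).integrable_comp_of_integrable (hint ψ hψ N (fun _ => y0) measurable_const)
    · intro γ
      rw [Function.iterate_add_apply]
      have : F^[k] (γ, y0) = (f^[k] γ, (F^[k] (γ, y0)).2) := by ext <;> simp [hfst]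
      rw [this]
      exact hN N le_rfl _ _ _
  -- the measures
  have hTm : ∀ n, Measurable fun γ => F^[n] (γ, y0) := fun n => (hFnm n).comp (by fun_prop)
  let μs : ℕ → ProbabilityMeasure (M × K) := fun n =>
    ⟨m₁.map fun γ => F^[n] (γ, y0), Measure.isProbabilityMeasure_map (hTm n).aemeasurable⟩
  have hμs : ∀ n, (μs n : Measure (M × K)) = m₁.map fun γ => F^[n] (γ, y0) := fun n => rfl
  have hμi : ∀ n (ψ : M × K → ℝ), Measurable ψ →
      ∫ p, ψ p ∂(μs n : Measure (M × K)) = ∫ γ, ψ (F^[n] (γ, y0)) ∂m₁ := by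
    intro n ψ hψ
    rw [hμs, integral_map (hTm n).aemeasurable hψ.aestronglyMeasurable]
  obtain ⟨μ₀, -, hμ₀⟩ := isCompact_univ.ultrafilter_le_nhds
    (Ultrafilter.map μs (hyperfilter ℕ)) (by simp)
  have hμ₀' : Tendsto μs (hyperfilter ℕ) (nhds μ₀) := hμ₀
  rw [ProbabilityMeasure.tendsto_iff_forall_integral_tendsto] at hμ₀'
  have hlim : ∀ ψ : M × K → ℝ, Continuous ψ →
      Tendsto (fun n : ℕ => ∫ γ, ψ (F^[n] (γ, y0)) ∂m₁) atTop
        (nhds (∫ p, ψ p ∂(μ₀ : Measure (M × K)))) := by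
    intro ψ hψ
    refine tendsto_nhds_of_cauchySeq_of_subseq (hcau ψ hψ) (f := id) (p := hyperfilter ℕ) ?_ ?_
    · exact Nat.hyperfilter_le_atTop
    · have := hμ₀' (BoundedContinuousFunction.mkOfCompact ⟨ψ, hψ⟩)
      refine this.congr fun n => ?_
      exact hμi n ψ hψ.measurable
  have hfstm : (μ₀ : Measure (M × K)).map Prod.fst = m₁ := by
    have : IsFiniteMeasure ((μ₀ : Measure (M × K)).map Prod.fst) := inferInstance
    apply ext_of_forall_integral_eq_of_IsFiniteMeasure
    intro g
    rw [integral_map measurable_fst.aemeasurable g.continuous.measurable.aestronglyMeasurable]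
    refine tendsto_nhds_unique (hlim (fun p => g p.1) (by fun_prop)) ?_
    refine tendsto_const_nhds.congr fun n => ?_
    simp only [hfst]
    conv_lhs => rw [← (hfn n).map_eq]
    rw [integral_map (hfn n).measurable.aemeasurable g.continuous.measurable.aestronglyMeasurable]
  refine ⟨μ₀, inferInstance, fun ψ hψ => ?_, ?_, hfstm⟩
  · obtain ⟨C, hC⟩ := hbd ψ hψ
    have hba : ∀ n γ, BddAbove (Set.range fun y => ψ (F^[n] (γ, y))) := fun n γ =>
      (isCompact_range (hψ.comp (hcont n γ))).bddAbove
    have hbb : ∀ n γ, BddBelow (Set.range fun y => ψ (F^[n] (γ, y))) := fun n γ =>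
      (isCompact_range (hψ.comp (hcont n γ))).bddBelow
    have hms : ∀ n, Measurable fun γ => ⨆ y, ψ (F^[n] (γ, y)) := fun n =>
      aux_meas_sup (fun γ y => ψ (F^[n] (γ, y))) (fun γ => hψ.comp (hcont n γ))
        (fun z => hψ.measurable.comp ((hFnm n).comp (by fun_prop)))
    have hmi : ∀ n, Measurable fun γ => ⨅ y, ψ (F^[n] (γ, y)) := by
      intro n
      have := (aux_meas_sup (fun γ y => -ψ (F^[n] (γ, y))) (fun γ => (hψ.comp (hcont n γ)).neg)
        (fun z => (hψ.measurable.comp ((hFnm n).comp (by fun_prop))).neg)).neg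
      convert this using 2 with γ
      change sInf _ = -sSup (Set.range fun y => -ψ (F^[n] (γ, y)))
      rw [← Real.sInf_neg]
      congr 1
      ext t
      simp [neg_eq_iff_eq_neg]
    have key : ∀ S : ℕ → M → ℝ, (∀ n, Measurable (S n)) →
        (∀ n γ ε, (∀ z, |ψ (F^[n] (γ, z)) - ψ (F^[n] (γ, y0))| ≤ ε) → |S n γ - ψ (F^[n] (γ, y0))| ≤ ε) →
        Tendsto (fun n => ∫ γ, S n γ ∂m₁) atTop (nhds (∫ p, ψ p ∂(μ₀ : Measure (M × K)))) := by
      intro S hS hSe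
      have h0 : Tendsto (fun n => ∫ γ, S n γ ∂m₁ - ∫ γ, ψ (F^[n] (γ, y0)) ∂m₁) atTop (nhds 0) := by
        apply Metric.tendsto_atTop.2
        intro ε hε
        obtain ⟨N, hN⟩ := hosc ψ hψ (ε / 2) (by positivity)
        refine ⟨N, fun n hn => ?_⟩
        rw [Real.dist_eq, sub_zero]
        have hp : ∀ γ, |S n γ - ψ (F^[n] (γ, y0))| ≤ ε / 2 := fun γ => hSe n γ _ fun z => hN n hn γ z y0
        refine lt_of_le_of_lt (hclose _ _ (ε / 2) ?_ (hint ψ hψ _ (fun _ => y0) measurable_const) hp)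
          (half_lt_self hε)
        refine Integrable.of_bound (C := C + ε / 2) (hS n).aestronglyMeasurable (ae_of_all _ fun γ => ?_)
        have h1 := hp γ
        have h2 := hC (F^[n] (γ, y0))
        rw [Real.norm_eq_abs]
        rw [abs_le] at *
        constructor <;> linarith
      simpa using h0.add (hlim ψ hψ)
    refine ⟨key _ hmi fun n γ ε h => ?_, key _ hms fun n γ ε h => ?_⟩
    · have h1 := ciInf_le (hbb n γ) y0
      have h2 : ψ (F^[n] (γ, y0)) - ε ≤ ⨅ y, ψ (F^[n] (γ, y)) :=
        le_ciInf fun z => by have := abs_le.1 (h z); linarith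
      have h3 := (abs_nonneg _).trans (h y0)
      rw [abs_le]; constructor <;> linarith
    · have h1 := le_ciSup (hba n γ) y0
      have h2 : ⨆ y, ψ (F^[n] (γ, y)) ≤ ψ (F^[n] (γ, y0)) + ε :=
        ciSup_le fun z => by have := abs_le.1 (h z); linarith
      have h3 := (abs_nonneg _).trans (h y0)
      rw [abs_le]; constructor <;> linarith
  · have : IsFiniteMeasure ((μ₀ : Measure (M × K)).map F) := inferInstance
    apply ext_of_forall_integral_eq_of_IsFiniteMeasure
    intro ψ
    have hψ : Continuous ψ := ψ.continuous
    obtain ⟨C, hC⟩ := hbd ψ hψ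
    rw [integral_map hFm.aemeasurable hψ.measurable.aestronglyMeasurable]
    let h : M → C(K, ℝ) := fun x => ⟨fun z => ψ (F (x, z)), hψ.comp (hcont 1 x)⟩
    have hh : StronglyMeasurable h := aux_meas_CK h fun z =>
      hψ.measurable.comp (hFm.comp (by fun_prop))
    have hhi : Integrable h m₁ := by
      refine Integrable.of_bound (C := C) hh.aestronglyMeasurable (ae_of_all _ fun x => ?_)
      rw [ContinuousMap.norm_le_of_nonempty]
      exact fun z => hC _
    -- main estimate
    have hest : ∀ ε > 0, |∫ p, ψ (F p) ∂(μ₀ : Measure (M × K)) - ∫ p, ψ p ∂(μ₀ : Measure (M × K))| ≤ 2 * ε := by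
      intro ε hε
      obtain ⟨g, hg, hgi⟩ := hhi.exists_boundedContinuous_integral_sub_le hε
      let Φ : M × K → ℝ := fun p => g p.1 p.2
      have hΦ : Continuous Φ := by
        have : Continuous fun p : M × K => (g p.1, p.2) := by fun_prop
        exact ContinuousEval.continuous_eval.comp this
      obtain ⟨C', hC'⟩ := hbd Φ hΦ
      have hgen : ∀ ν : ProbabilityMeasure (M × K), (ν : Measure (M × K)).map Prod.fst = m₁ →
          |∫ p, ψ (F p) ∂(ν : Measure (M × K)) - ∫ p, Φ p ∂(ν : Measure (M × K))| ≤ ε := by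
        intro ν hν
        have i1 : Integrable (fun p => ψ (F p)) (ν : Measure (M × K)) :=
          Integrable.of_bound (C := C) (hψ.measurable.comp hFm).aestronglyMeasurable
            (ae_of_all _ fun p => hC _)
        have i2 : Integrable Φ (ν : Measure (M × K)) :=
          Integrable.of_bound (C := C') hΦ.measurable.aestronglyMeasurable
            (ae_of_all _ fun p => hC' _)
        have i3 : Integrable (fun x => ‖h x - g x‖) m₁ := (hhi.sub hgi).norm
        rw [← integral_sub i1 i2]
        refine le_trans ?_ hg
        have e : ∫ x, ‖h x - g x‖ ∂m₁ = ∫ p, ‖h p.1 - g p.1‖ ∂(ν : Measure (M × K)) := by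
          conv_lhs => rw [← hν]
          rw [integral_map measurable_fst.aemeasurable]
          rw [hν]; exact i3.aestronglyMeasurable
        rw [e, ← Real.norm_eq_abs]
        refine norm_integral_le_of_norm_le ?_ (ae_of_all _ fun p => ?_)
        · rw [← hν] at i3
          exact i3.comp_measurable measurable_fst
        · exact (h p.1 - g p.1).norm_coe_le_norm p.2
      have hμfst : ∀ n, (μs n : Measure (M × K)).map Prod.fst = m₁ := by
        intro n
        rw [hμs, Measure.map_map measurable_fst (hTm n)]
        have : (Prod.fst ∘ fun γ => F^[n] (γ, y0)) = f^[n] := by ext γ; simp [hfst]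
        rw [this, (hfn n).map_eq]
      have l1 : Tendsto (fun n => ∫ p, ψ (F p) ∂(μs n : Measure (M × K))) atTop
          (nhds (∫ p, ψ p ∂(μ₀ : Measure (M × K)))) := by
        refine ((hlim ψ hψ).comp (tendsto_add_atTop_nat 1)).congr fun n => ?_
        rw [hμi n (fun p => ψ (F p)) (hψ.measurable.comp hFm)]
        simp only [Function.comp, Function.iterate_succ_apply']
      have l2 : Tendsto (fun n => ∫ p, Φ p ∂(μs n : Measure (M × K))) atTop
          (nhds (∫ p, Φ p ∂(μ₀ : Measure (M × K)))) := by
        refine (hlim Φ hΦ).congr fun n => (hμi n Φ hΦ.measurable).symm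
      have h1 := le_of_tendsto (l1.sub l2).abs (Eventually.of_forall fun n => hgen (μs n) (hμfst n))
      have h2 := hgen μ₀ hfstm
      rw [abs_le] at *
      constructor <;> linarith
    rw [← sub_eq_zero, ← abs_nonpos_iff]
    refine le_of_forall_pos_le_add fun ε hε => ?_
    have := hest (ε / 2) (by positivity)
    linarith

/-- Existence and uniqueness of the limit measure for the skew product
`F(x,z) = (f(x), G(x,z))` with uniformly contracting fibers: there is a unique finite Borel
measure `μ₀` on `Σ = M × K` such that for every continuous `ψ : Σ → ℝ` both
`∫ inf_{{γ}×K} ψ∘Fⁿ dm₁` and `∫ sup_{{γ}×K} ψ∘Fⁿ dm₁` converge to `∫ ψ dμ₀`; moreover `μ₀` is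
`F`-invariant and its first marginal is `m₁`. -/
theorem exists_unique_limit_measure {M K : Type*}
    [MetricSpace M] [CompactSpace M] [MeasurableSpace M] [BorelSpace M]
    [MetricSpace K] [CompactSpace K] [MeasurableSpace K] [BorelSpace K] [Nonempty K]
    (m₁ : Measure M) [IsProbabilityMeasure m₁]
    (f : M → M) (hf : Measurable f) (hfinv : m₁.map f = m₁)
    (G : M × K → K) (hG : Measurable G)
    (α : ℝ) (hα0 : 0 < α) (hα1 : α < 1)
    (hGc : ∀ᵐ x ∂m₁, ∀ z₁ z₂ : K, dist (G (x, z₁)) (G (x, z₂)) ≤ α * dist z₁ z₂)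
    (F : M × K → M × K) (hF : ∀ p, F p = (f p.1, G p)) :
    ∃ μ₀ : Measure (M × K), IsFiniteMeasure μ₀ ∧
      (∀ ψ : M × K → ℝ, Continuous ψ →
        Tendsto (fun n : ℕ => ∫ γ, (⨅ y : K, ψ (F^[n] (γ, y))) ∂m₁) atTop
          (nhds (∫ p, ψ p ∂μ₀)) ∧
        Tendsto (fun n : ℕ => ∫ γ, (⨆ y : K, ψ (F^[n] (γ, y))) ∂m₁) atTop
          (nhds (∫ p, ψ p ∂μ₀))) ∧
      (∀ μ' : Measure (M × K), IsFiniteMeasure μ' →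
        (∀ ψ : M × K → ℝ, Continuous ψ →
          Tendsto (fun n : ℕ => ∫ γ, (⨅ y : K, ψ (F^[n] (γ, y))) ∂m₁) atTop
            (nhds (∫ p, ψ p ∂μ')) ∧
          Tendsto (fun n : ℕ => ∫ γ, (⨆ y : K, ψ (F^[n] (γ, y))) ∂m₁) atTop
            (nhds (∫ p, ψ p ∂μ'))) → μ' = μ₀) ∧
      μ₀.map F = μ₀ ∧ μ₀.map Prod.fst = m₁ := by
  obtain ⟨y0⟩ := ‹Nonempty K›
  have : Nonempty K := ⟨y0⟩
  classical
  obtain ⟨B, hB1, hBm, hB0⟩ := exists_measurable_superset_of_null (ae_iff.1 hGc)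
  let G' : M × K → K := fun p => if p.1 ∈ B then y0 else G p
  have hG' : Measurable G' :=
    Measurable.ite (measurable_fst hBm) measurable_const hG
  have hBc : ∀ᵐ x ∂m₁, x ∉ B := by
    rw [ae_iff]; simpa using hB0
  have hfp : MeasurePreserving f m₁ m₁ := ⟨hf, hfinv⟩
  let F' : M × K → M × K := fun p => (f p.1, G' p)
  have hFF : ∀ p : M × K, p.1 ∉ B → F' p = F p := by
    intro p hp
    simp only [F', G', hF, if_neg hp]
  have hit : ∀ᵐ x ∂m₁, ∀ n : ℕ, f^[n] x ∉ B := by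
    rw [ae_all_iff]
    exact fun n => (hfp.iterate n).quasiMeasurePreserving.ae hBc
  have hiter : ∀ (n : ℕ) (x : M) (z : K), (∀ n : ℕ, f^[n] x ∉ B) → F'^[n] (x, z) = F^[n] (x, z) := by
    intro n
    induction n with
    | zero => intro x z _; rfl
    | succ n ih =>
      intro x z hx
      rw [Function.iterate_succ_apply, Function.iterate_succ_apply, hFF _ (hx 0), hF]
      exact ih _ _ fun k => hx (k + 1)
  obtain ⟨μ₀, hfin, hlim, hinv, hmarg⟩ := aux_core m₁ f hf hfinv G' hG' α hα0 hα1 (by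
    intro x z₁ z₂
    by_cases hx : x ∈ B
    · simp only [G', if_pos hx, dist_self]; positivity
    · simp only [G', if_neg hx]
      by_contra hcon
      exact hx (hB1 fun h => hcon (h z₁ z₂))) F' (fun p => rfl)
  have hlim' : ∀ ψ : M × K → ℝ, Continuous ψ →
        Tendsto (fun n : ℕ => ∫ γ, (⨅ y : K, ψ (F^[n] (γ, y))) ∂m₁) atTop
          (nhds (∫ p, ψ p ∂μ₀)) ∧
        Tendsto (fun n : ℕ => ∫ γ, (⨆ y : K, ψ (F^[n] (γ, y))) ∂m₁) atTop
          (nhds (∫ p, ψ p ∂μ₀)) := by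
    intro ψ hψ
    refine ⟨(hlim ψ hψ).1.congr fun n => integral_congr_ae ?_,
      (hlim ψ hψ).2.congr fun n => integral_congr_ae ?_⟩
    all_goals
      filter_upwards [hit] with x hx
      simp only [hiter n x _ hx]
  refine ⟨μ₀, hfin, hlim', ?_, ?_, hmarg⟩
  · intro μ' hμ' h'
    apply ext_of_forall_integral_eq_of_IsFiniteMeasure
    intro ψ
    exact tendsto_nhds_unique (h' ψ ψ.continuous).1 (hlim' ψ ψ.continuous).1
  · rw [← hinv]
    have : F =ᵐ[μ₀] F' := by
      have h1 : ∀ᵐ x ∂(μ₀.map Prod.fst), x ∉ B := by rw [hmarg]; exact hBc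
      filter_upwards [ae_of_ae_map measurable_fst.aemeasurable h1] with p hp
      exact (hFF p hp).symm
    rw [hinv, Measure.map_congr this, hinv]
end

section
/- The skew product F has exactly one invariant Borel probability measure μ₀ belonging to the space S^∞; moreover π_{x*}μ₀ = m₁ (its marginal density with respect to m₁ is constant equal to 1). -/
open MeasureTheory ProbabilityTheory Filter ENNReal

section Setting

variable {M : Type*} {K : Type*}
variable [MetricSpace M] [CompactSpace M] [MeasurableSpace M] [BorelSpace M]
variable [MetricSpace K] [CompactSpace K] [MeasurableSpace K] [BorelSpace K]
variable [StandardBorelSpace K] [Nonempty K]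

open scoped Classical in
/-- A finite measure regarded as a signed measure (and `0` on non-finite measures). -/
noncomputable def toSM {X : Type*} [MeasurableSpace X] (μ : Measure X) : SignedMeasure X :=
  if h : IsFiniteMeasure μ then @Measure.toSignedMeasure _ _ μ h else 0

/-- The restriction `μ|_γ = φ_x(γ)·π_{y*}μ_γ` of a positive finite measure on `M × K` to the
fiber over `γ`, where `φ_x = d(π_{x*}μ)/dm₁` and `μ_γ` is the conditional (Rokhlin) fiber
measure of `μ` over the first coordinate. -/
noncomputable def fiberPos (m₁ : Measure M) (μ : Measure (M × K)) [IsFiniteMeasure μ] (γ : M) :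
    SignedMeasure K :=
  (μ.fst.rnDeriv m₁ γ).toReal • toSM (μ.condKernel γ)

/-- The restriction `μ|_γ = μ⁺|_γ − μ⁻|_γ` of a signed measure on `M × K` to the fiber over
`γ`, via the Jordan decomposition. -/
noncomputable def fiberS (m₁ : Measure M) (μ : SignedMeasure (M × K)) (γ : M) :
    SignedMeasure K :=
  fiberPos m₁ μ.toJordanDecomposition.posPart γ - fiberPos m₁ μ.toJordanDecomposition.negPart γ

/-- `‖μ‖_∞ := m₁-esssup_γ ‖μ|_γ‖_W` (with values in `ℝ≥0∞`). -/
noncomputable def infNormE (ζ : ℝ) (m₁ : Measure M) (μ : SignedMeasure (M × K)) : ℝ≥0∞ :=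
  essSup (fun γ => ENNReal.ofReal (wNorm ζ (fiberS m₁ μ γ))) m₁

/-- Membership in `L^∞`: both Jordan marginals are absolutely continuous w.r.t. `m₁` and
`‖μ‖_∞ < ∞`. -/
def memLinf (ζ : ℝ) (m₁ : Measure M) (μ : SignedMeasure (M × K)) : Prop :=
  μ.toJordanDecomposition.posPart.fst ≪ m₁ ∧ μ.toJordanDecomposition.negPart.fst ≪ m₁ ∧
    infNormE ζ m₁ μ < ⊤

/-- The marginal density `φ_x = d(π_{x*}μ)/dm₁` of a signed measure on `M × K`. -/
noncomputable def signedDensity (m₁ : Measure M) (μ : SignedMeasure (M × K)) (γ : M) : ℝ :=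
  (μ.toJordanDecomposition.posPart.fst.rnDeriv m₁ γ).toReal -
    (μ.toJordanDecomposition.negPart.fst.rnDeriv m₁ γ).toReal

/-- The `ζ`-Hölder constant `H_ζ(φ)` (with values in `ℝ≥0∞`; it is `⊤` iff `φ` is not
`ζ`-Hölder). -/
noncomputable def hC {X : Type*} [MetricSpace X] (ζ : ℝ) (φ : X → ℝ) : ℝ≥0∞ :=
  ⨆ (x : X) (y : X) (_ : x ≠ y), ENNReal.ofReal (|φ x - φ y| / dist x y ^ ζ)

/-- The `ζ`-Hölder norm `|φ|_ζ = sup|φ| + H_ζ(φ)` (with values in `ℝ≥0∞`). -/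
noncomputable def hNormE {X : Type*} [MetricSpace X] (ζ : ℝ) (φ : X → ℝ) : ℝ≥0∞ :=
  (⨆ x : X, ENNReal.ofReal |φ x|) + hC ζ φ

/-- Membership in `S^∞`: `μ ∈ L^∞` and the marginal density has a `ζ`-Hölder version. -/
def memSinf (ζ : ℝ) (m₁ : Measure M) (μ : SignedMeasure (M × K)) : Prop :=
  memLinf ζ m₁ μ ∧ ∃ φ : M → ℝ, φ =ᵐ[m₁] signedDensity m₁ μ ∧ hC ζ φ < ⊤

/-- The `S^∞` norm `‖μ‖_{S^∞} = |φ_x|_ζ + ‖μ‖_∞` (infimum of `|·|_ζ` over versions of the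
marginal density; with values in `ℝ≥0∞`). -/
noncomputable def sNormE (ζ : ℝ) (m₁ : Measure M) (μ : SignedMeasure (M × K)) : ℝ≥0∞ :=
  (⨅ (φ : M → ℝ) (_ : φ =ᵐ[m₁] signedDensity m₁ μ), hNormE ζ φ) + infNormE ζ m₁ μ

/-- The transfer (Perron–Frobenius) operator of `f` with respect to `m₁`:
`P_f φ = d(f_*(φ·m₁))/dm₁`. -/
noncomputable def Pf {X : Type*} [MeasurableSpace X] (m₁ : Measure X) (f : X → X)
    (φ : X → ℝ) : X → ℝ := fun γ =>
  (((m₁.withDensity fun x => ENNReal.ofReal (φ x)).map f).rnDeriv m₁ γ).toReal -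
    (((m₁.withDensity fun x => ENNReal.ofReal (-φ x)).map f).rnDeriv m₁ γ).toReal

end Setting


lemma exists_top {M β : Type*} [mM : MeasurableSpace M] [StandardBorelSpace M]
    [tβ : TopologicalSpace β] [MeasurableSpace β] [OpensMeasurableSpace β]
    [SecondCountableTopology β] (f : M → M) (hf : Measurable f) (H : M → β) (hH : Measurable H) :
    ∃ t : TopologicalSpace M, @PolishSpace M t ∧ @BorelSpace M t mM ∧ @Continuous M M t t f ∧
      @Continuous M β t tβ H := by
  obtain ⟨t0, hB0, hP0⟩ := (inferInstance : StandardBorelSpace M).polish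
  obtain ⟨t1, ht1, hH1, hP1⟩ := hH.exists_continuous
  have hB1 : @BorelSpace M t1 mM := by
    refine @BorelSpace.mk _ t1 _ ?_
    rw [borel_eq_borel_of_le hP1 hP0 ht1]
    exact hB0.measurable_eq
  have step : ∀ s : {t : TopologicalSpace M // @PolishSpace M t ∧ @BorelSpace M t mM},
      ∃ s' : {t : TopologicalSpace M // @PolishSpace M t ∧ @BorelSpace M t mM},
        s'.1 ≤ s.1 ∧ @Continuous M M s'.1 s.1 f := by
    rintro ⟨s, hP, hB⟩
    obtain ⟨t', ht', hc, hP'⟩ := hf.exists_continuous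
    refine ⟨⟨t', hP', ?_⟩, ht', hc⟩
    refine @BorelSpace.mk _ t' _ ?_
    rw [borel_eq_borel_of_le hP' hP ht']
    exact hB.measurable_eq
  choose nx hnx hnc using step
  let T : ℕ → {t : TopologicalSpace M // @PolishSpace M t ∧ @BorelSpace M t mM} := fun n =>
    nx^[n] ⟨t1, hP1, hB1⟩
  have hT : ∀ n, T (n+1) = nx (T n) := fun n => Function.iterate_succ_apply' _ _ _
  have hle : ∀ n, (T n).1 ≤ (T 0).1 := by
    intro n
    induction n with
    | zero => exact le_rfl
    | succ n ih => rw [hT]; exact (hnx _).trans ih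
  have hP : @PolishSpace M (⨅ n, (T n).1) := PolishSpace.iInf ⟨0, hle⟩ (fun n => (T n).2.1)
  refine ⟨⨅ n, (T n).1, hP, ?_, ?_, ?_⟩
  · refine @BorelSpace.mk _ (⨅ n, (T n).1) _ ?_
    rw [borel_eq_borel_of_le hP (T 0).2.1 (iInf_le _ 0)]
    exact (T 0).2.2.measurable_eq
  · rw [continuous_iInf_rng]
    intro n
    refine continuous_iInf_dom (i := n+1) ?_
    rw [hT]
    exact hnc _
  · exact continuous_iInf_dom (i := 0) hH1

lemma eq_of_lip {X : Type*} [MeasurableSpace X] [MetricSpace X] [BorelSpace X]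
    (μ ν : Measure X) [IsProbabilityMeasure μ] [IsProbabilityMeasure ν]
    (h : ∀ g : X → ℝ, (∃ C : ℝ, ∀ x y, dist (g x) (g y) ≤ C) → (∃ L, LipschitzWith L g) →
      ∫ x, g x ∂μ = ∫ x, g x ∂ν) : μ = ν := by
  let μ' : ProbabilityMeasure X := ⟨μ, inferInstance⟩
  let ν' : ProbabilityMeasure X := ⟨ν, inferInstance⟩
  have h1 : Tendsto (fun _ : ℕ => μ') atTop (nhds ν') := by
    rw [tendsto_iff_forall_lipschitz_integral_tendsto]
    intro g hC hL
    have := h g hC hL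
    simp only [μ', ν', ProbabilityMeasure.coe_mk]
    rw [this]
    exact tendsto_const_nhds
  have h2 := tendsto_nhds_unique h1 tendsto_const_nhds
  exact congrArg (fun p : ProbabilityMeasure X => (p : Measure X)) h2.symm

lemma integrable_bl {X : Type*} [MeasurableSpace X] (μ : Measure X) [IsProbabilityMeasure μ]
    (g : X → ℝ) (hm : Measurable g) (hC : ∃ C : ℝ, ∀ x y, dist (g x) (g y) ≤ C) :
    Integrable g μ := by
  obtain ⟨C, hC⟩ := hC
  have : Nonempty X := nonempty_of_isProbabilityMeasure μ
  let x0 : X := Classical.arbitrary X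
  refine Integrable.of_bound hm.aestronglyMeasurable (|g x0| + C) ?_
  filter_upwards with x
  have := hC x x0
  rw [Real.dist_eq] at this
  rw [Real.norm_eq_abs]
  have := abs_sub_abs_le_abs_sub (g x) (g x0)
  linarith

lemma iter_contr {M K : Type*} [MetricSpace M] [MetricSpace K] (f : M → M) (G : M × K → K)
    (α : ℝ) (hα0 : 0 < α) 
    (hGc : ∀ x, ∀ z₁ z₂ : K, dist (G (x, z₁)) (G (x, z₂)) ≤ α * dist z₁ z₂)
    (n : ℕ) (x : M) (z₁ z₂ : K) :
    dist ((fun p : M × K => (f p.1, G p))^[n] (x, z₁)) ((fun p : M × K => (f p.1, G p))^[n] (x, z₂))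
      ≤ α ^ n * dist z₁ z₂ := by
  induction n generalizing x z₁ z₂ with
  | zero => simp [Prod.dist_eq]
  | succ n ih =>
    simp only [Function.iterate_succ, Function.comp]
    refine (ih _ _ _).trans ?_
    rw [pow_succ, mul_assoc]
    exact mul_le_mul_of_nonneg_left (hGc _ _ _) (by positivity)

lemma int_close {M K : Type*} [MetricSpace M] [MeasurableSpace M] [BorelSpace M]
    [SecondCountableTopology M]
    [MetricSpace K] [CompactSpace K] [MeasurableSpace K] [BorelSpace K] (z0 : K)
    (hdK : Metric.diam (Set.univ : Set K) ≤ 1) (m₁ : Measure M) [IsProbabilityMeasure m₁]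
    (f : M → M) (hf : Measurable f) (G : M × K → K) (hG : Measurable G)
    (α : ℝ) (hα0 : 0 < α) 
    (hGc : ∀ x, ∀ z₁ z₂ : K, dist (G (x, z₁)) (G (x, z₂)) ≤ α * dist z₁ z₂)
    (ρ : Measure (M × K)) [IsProbabilityMeasure ρ] (hρ : ρ.map Prod.fst = m₁)
    (g : M × K → ℝ) (hC : ∃ C : ℝ, ∀ x y, dist (g x) (g y) ≤ C) (L : NNReal)
    (hL : LipschitzWith L g) (n : ℕ) :
    |∫ p, g ((fun p : M × K => (f p.1, G p))^[n] p) ∂ρ -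
      ∫ x, g ((fun p : M × K => (f p.1, G p))^[n] (x, z0)) ∂m₁| ≤ L * α ^ n := by
  have hgm : Measurable g := hL.continuous.measurable
  have hFm : Measurable (fun p : M × K => (f p.1, G p)) := (hf.comp measurable_fst).prodMk hG
  have hFn := hFm.iterate n
  set F : M × K → M × K := fun p => (f p.1, G p) with hF
  have hC' : ∃ C : ℝ, ∀ x y, dist (g (F^[n] x)) (g (F^[n] y)) ≤ C := by
    obtain ⟨C, hC⟩ := hC
    exact ⟨C, fun _ _ => hC _ _⟩
  have hC'' : ∃ C : ℝ, ∀ x y : M × K, dist (g (F^[n] (x.1, z0))) (g (F^[n] (y.1, z0))) ≤ C := by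
    obtain ⟨C, hC⟩ := hC
    exact ⟨C, fun _ _ => hC _ _⟩
  have m2 : Measurable fun x : M => g (F^[n] (x, z0)) := hgm.comp (hFn.comp measurable_prodMk_right)
  have i1 : Integrable (fun p => g (F^[n] p)) ρ := integrable_bl ρ _ (hgm.comp hFn) hC'
  have i2 : Integrable (fun p : M × K => g (F^[n] (p.1, z0))) ρ :=
    integrable_bl ρ _ (m2.comp measurable_fst) hC''
  rw [← hρ, integral_map measurable_fst.aemeasurable m2.aestronglyMeasurable,
    ← integral_sub i1 i2]
  have := norm_integral_le_of_norm_le_const (μ := ρ) (C := L * α ^ n)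
    (f := fun p : M × K => g (F^[n] p) - g (F^[n] (p.1, z0))) ?_
  · simpa using this
  · filter_upwards with p
    rw [← dist_eq_norm]
    refine (hL.dist_le_mul _ _).trans ?_
    refine mul_le_mul_of_nonneg_left ?_ L.2
    refine (iter_contr f G α hα0 hGc n p.1 p.2 z0).trans ?_
    have : dist p.2 z0 ≤ 1 := (Metric.dist_le_diam_of_mem
      (isCompact_univ.isBounded) (Set.mem_univ _) (Set.mem_univ _)).trans hdK
    have h0 : 0 ≤ α ^ n := by positivity
    nlinarith

lemma int_lim {M K : Type*} [MetricSpace M] [MeasurableSpace M] [BorelSpace M]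
    [SecondCountableTopology M]
    [MetricSpace K] [CompactSpace K] [MeasurableSpace K] [BorelSpace K] [Nonempty K]
    (hdK : Metric.diam (Set.univ : Set K) ≤ 1) (m₁ : Measure M) [IsProbabilityMeasure m₁]
    (f : M → M) (hf : Measurable f) (G : M × K → K) (hG : Measurable G)
    (α : ℝ) (hα0 : 0 < α) (hα1 : α < 1)
    (hGc : ∀ x, ∀ z₁ z₂ : K, dist (G (x, z₁)) (G (x, z₂)) ≤ α * dist z₁ z₂)
    (ρ ρ' : Measure (M × K)) [IsProbabilityMeasure ρ] (hρ : ρ.map Prod.fst = m₁)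
    [IsProbabilityMeasure ρ'] (hρ' : ρ'.map Prod.fst = m₁)
    (g : M × K → ℝ) (hC : ∃ C : ℝ, ∀ x y, dist (g x) (g y) ≤ C) (L : NNReal)
    (hL : LipschitzWith L g) :
    Tendsto (fun n : ℕ => ∫ p, g ((fun p : M × K => (f p.1, G p))^[n] p) ∂ρ -
      ∫ p, g ((fun p : M × K => (f p.1, G p))^[n] p) ∂ρ') atTop (nhds 0) := by
  obtain ⟨z0⟩ := (inferInstance : Nonempty K)
  refine squeeze_zero_norm (a := fun n => 2 * (L * α ^ n)) (fun n => ?_) ?_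
  · have h1 := int_close z0 hdK m₁ f hf G hG α hα0 hGc ρ hρ g hC L hL n
    have h2 := int_close z0 hdK m₁ f hf G hG α hα0 hGc ρ' hρ' g hC L hL n
    rw [Real.norm_eq_abs]
    rw [abs_le] at *
    constructor <;> linarith [h1.1, h1.2, h2.1, h2.2]
  · have := (tendsto_pow_atTop_nhds_zero_of_lt_one hα0.le hα1).const_mul (2 * (L:ℝ))
    simpa [mul_assoc] using this

lemma iter_inv {X : Type*} [MeasurableSpace X] (μ : Measure X) (F : X → X) (hF : Measurable F)
    (h : μ.map F = μ) (n : ℕ) : μ.map F^[n] = μ := by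
  have : MeasurePreserving F μ μ := ⟨hF, h⟩
  exact (this.iterate n).map_eq

lemma unique_inv {M K : Type*} [MetricSpace M] [MeasurableSpace M] [BorelSpace M]
    [SecondCountableTopology M]
    [MetricSpace K] [CompactSpace K] [MeasurableSpace K] [BorelSpace K] [Nonempty K]
    (hdK : Metric.diam (Set.univ : Set K) ≤ 1) (m₁ : Measure M) [IsProbabilityMeasure m₁]
    (f : M → M) (hf : Measurable f) (G : M × K → K) (hG : Measurable G)
    (α : ℝ) (hα0 : 0 < α) (hα1 : α < 1)
    (hGc : ∀ x, ∀ z₁ z₂ : K, dist (G (x, z₁)) (G (x, z₂)) ≤ α * dist z₁ z₂)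
    (ρ ρ' : Measure (M × K)) [IsProbabilityMeasure ρ] (hρ : ρ.map Prod.fst = m₁)
    [IsProbabilityMeasure ρ'] (hρ' : ρ'.map Prod.fst = m₁)
    (hi : ρ.map (fun p : M × K => (f p.1, G p)) = ρ)
    (hi' : ρ'.map (fun p : M × K => (f p.1, G p)) = ρ') : ρ = ρ' := by
  have hFm : Measurable (fun p : M × K => (f p.1, G p)) := (hf.comp measurable_fst).prodMk hG
  apply eq_of_lip
  rintro g hC ⟨L, hL⟩
  have hgm : Measurable g := hL.continuous.measurable
  have h := int_lim hdK m₁ f hf G hG α hα0 hα1 hGc ρ ρ' hρ hρ' g hC L hL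
  have e : ∀ (σ : Measure (M × K)), σ.map (fun p : M × K => (f p.1, G p)) = σ → ∀ n : ℕ,
      ∫ p, g ((fun p : M × K => (f p.1, G p))^[n] p) ∂σ = ∫ p, g p ∂σ := by
    intro σ hσ n
    conv_rhs => rw [← iter_inv σ _ hFm hσ n]
    rw [integral_map (hFm.iterate n).aemeasurable hgm.aestronglyMeasurable]
  simp_rw [e ρ hi, e ρ' hi'] at h
  have := tendsto_nhds_unique h tendsto_const_nhds
  linarith

lemma exists_inv_cont {M K : Type*} [TopologicalSpace M] [PolishSpace M] [MeasurableSpace M]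
    [BorelSpace M]
    [MetricSpace K] [CompactSpace K] [MeasurableSpace K] [BorelSpace K] [Nonempty K]
    (hdK : Metric.diam (Set.univ : Set K) ≤ 1) (m₁ : Measure M) [IsProbabilityMeasure m₁]
    (f : M → M) (hf : Continuous f) (hfinv : m₁.map f = m₁) (G : M × K → K) (hG : Continuous G)
    (α : ℝ) (hα0 : 0 < α) (hα1 : α < 1)
    (hGc : ∀ x, ∀ z₁ z₂ : K, dist (G (x, z₁)) (G (x, z₂)) ≤ α * dist z₁ z₂) :
    ∃ μ : Measure (M × K), IsProbabilityMeasure μ ∧ μ.map (fun p : M × K => (f p.1, G p)) = μ ∧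
      μ.map Prod.fst = m₁ := by
  let _ := TopologicalSpace.upgradeIsCompletelyMetrizable M
  obtain ⟨z0⟩ := (inferInstance : Nonempty K)
  have hFc : Continuous (fun p : M × K => (f p.1, G p)) := (hf.comp continuous_fst).prodMk hG
  have hlim := int_lim hdK m₁ f hf.measurable G hG.measurable α hα0 hα1 hGc
  set F : M × K → M × K := fun p => (f p.1, G p) with hF
  have hFm : Measurable F := hFc.measurable
  have marg : ∀ ρ : Measure (M × K), ρ.map Prod.fst = m₁ → (ρ.map F).map Prod.fst = m₁ := by
    intro ρ h
    rw [Measure.map_map measurable_fst hFm]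
    have : Prod.fst ∘ F = f ∘ Prod.fst := rfl
    rw [this, ← Measure.map_map hf.measurable measurable_fst, h, hfinv]
  have margn : ∀ ρ : Measure (M × K), ρ.map Prod.fst = m₁ → ∀ n, (ρ.map F^[n]).map Prod.fst = m₁ := by
    intro ρ h n
    induction n with
    | zero => simpa using h
    | succ n ih =>
      rw [Function.iterate_succ', ← Measure.map_map hFm (hFm.iterate n)]
      exact marg _ ih
  let ρ : Measure (M × K) := m₁.map (fun x => (x, z0))
  have hρp : IsProbabilityMeasure ρ := Measure.isProbabilityMeasure_map (by fun_prop)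
  have hρ : ρ.map Prod.fst = m₁ := by
    simp only [ρ]
    rw [Measure.map_map measurable_fst (by fun_prop)]
    exact Measure.map_id
  have hρp' : IsProbabilityMeasure (ρ.map F) := Measure.isProbabilityMeasure_map hFm.aemeasurable
  let u : ℕ → ProbabilityMeasure (M × K) := fun n =>
    ⟨ρ.map F^[n], Measure.isProbabilityMeasure_map (hFm.iterate n).aemeasurable⟩
  have htight : IsTightMeasureSet {((μ : ProbabilityMeasure (M × K)) : Measure (M × K)) |
      μ ∈ Set.range u} := by
    rw [isTightMeasureSet_iff_exists_isCompact_measure_compl_le]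
    intro ε hε
    obtain ⟨C, hC, hCε⟩ := isTightMeasureSet_iff_exists_isCompact_measure_compl_le.1
      (isTightMeasureSet_singleton (μ := m₁)) ε hε
    refine ⟨C ×ˢ Set.univ, hC.prod isCompact_univ, ?_⟩
    rintro _ ⟨_, ⟨n, rfl⟩, rfl⟩
    have : (C ×ˢ (Set.univ : Set K))ᶜ = Prod.fst ⁻¹' Cᶜ := by ext; simp
    rw [this, ← Measure.map_apply measurable_fst hC.measurableSet.compl]
    have := margn ρ hρ n
    simp only [u, ProbabilityMeasure.coe_mk]
    rw [this]
    exact hCε _ rfl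
  obtain ⟨ν, -, hν⟩ := (isCompact_closure_of_isTightMeasureSet htight).exists_mapClusterPt
    (f := atTop) (u := u) (by
      simp only [Filter.le_principal_iff]
      exact Filter.mem_map.2 (Filter.univ_mem' fun n => subset_closure ⟨n, rfl⟩))
  obtain ⟨U, hU, hUν⟩ := mapClusterPt_iff_ultrafilter.1 hν
  rw [ProbabilityMeasure.tendsto_iff_forall_integral_tendsto] at hUν
  have hFν : IsProbabilityMeasure ((ν : Measure (M × K)).map F) :=
    Measure.isProbabilityMeasure_map hFm.aemeasurable
  refine ⟨ν, inferInstance, ?_, ?_⟩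
  · symm
    apply eq_of_lip
    rintro g ⟨C, hC⟩ ⟨L, hL⟩
    have hgm : Measurable g := hL.continuous.measurable
    have h0 := (hlim ρ (ρ.map F) hρ (marg ρ hρ) g ⟨C, hC⟩ L hL).mono_left hU
    have h1 := hUν ⟨⟨g, hL.continuous⟩, C, hC⟩
    have h2 := hUν ⟨⟨fun p => g (F p), hL.continuous.comp hFc⟩, C, fun _ _ => hC _ _⟩
    have h3 := tendsto_nhds_unique h0 (a := 0)
      (b := ∫ p, g p ∂(ν : Measure (M × K)) - ∫ p, g (F p) ∂(ν : Measure (M × K))) (by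
      refine (h1.sub h2).congr fun n => ?_
      simp only [u, ProbabilityMeasure.coe_mk]
      congr 1
      · exact integral_map (hFm.iterate n).aemeasurable hgm.aestronglyMeasurable
      · have e2 : ∫ p, g (F^[n] p) ∂(ρ.map F) = ∫ p, g (F^[n] (F p)) ∂ρ :=
          integral_map hFm.aemeasurable (hgm.comp (hFm.iterate n)).aestronglyMeasurable
        rw [e2]
        refine (integral_map (hFm.iterate n).aemeasurable
          (hgm.comp hFm).aestronglyMeasurable).trans ?_
        refine integral_congr_ae (Eventually.of_forall fun p => ?_)
        change g (F (F^[n] p)) = g (F^[n] (F p))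
        rw [← Function.iterate_succ_apply F n p, ← Function.iterate_succ_apply' F n p])
    rw [integral_map hFm.aemeasurable hgm.aestronglyMeasurable]
    linarith
  · have : IsProbabilityMeasure ((ν : Measure (M × K)).map Prod.fst) :=
      Measure.isProbabilityMeasure_map measurable_fst.aemeasurable
    apply eq_of_lip
    rintro g ⟨C, hC⟩ ⟨L, hL⟩
    have hgm : Measurable g := hL.continuous.measurable
    have h1 := hUν ⟨⟨fun p => g p.1, hL.continuous.comp continuous_fst⟩, C, fun _ _ => hC _ _⟩
    rw [integral_map measurable_fst.aemeasurable hgm.aestronglyMeasurable]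
    refine tendsto_nhds_unique h1 (tendsto_const_nhds.congr fun n => ?_)
    simp only [u, ProbabilityMeasure.coe_mk]
    have := margn ρ hρ n
    rw [← this, integral_map measurable_fst.aemeasurable hgm.aestronglyMeasurable]
    rfl

lemma exists_inv {M K : Type*} [mM : MeasurableSpace M] [StandardBorelSpace M]
    [MetricSpace K] [CompactSpace K] [MeasurableSpace K] [BorelSpace K] [Nonempty K]
    (hdK : Metric.diam (Set.univ : Set K) ≤ 1) (m₁ : Measure M) [IsProbabilityMeasure m₁]
    (f : M → M) (hf : Measurable f) (hfinv : m₁.map f = m₁) (G : M × K → K) (hG : Measurable G)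
    (α : ℝ) (hα0 : 0 < α) (hα1 : α < 1)
    (hGc : ∀ x, ∀ z₁ z₂ : K, dist (G (x, z₁)) (G (x, z₂)) ≤ α * dist z₁ z₂) :
    ∃ μ : Measure (M × K), IsProbabilityMeasure μ ∧ μ.map (fun p : M × K => (f p.1, G p)) = μ ∧
      μ.map Prod.fst = m₁ := by
  let H : M → ℕ → K := fun x i => G (x, TopologicalSpace.denseSeq K i)
  have hH : Measurable H := measurable_pi_lambda _ fun i => hG.comp measurable_prodMk_right
  obtain ⟨t, hP, hB, hfc, hHc⟩ := exists_top f hf H hH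
  refine exists_inv_cont hdK m₁ f hfc hfinv G ?_ α hα0 hα1 hGc
  rw [continuous_iff_continuousAt]
  rintro ⟨x, z⟩
  rw [ContinuousAt, Metric.tendsto_nhds]
  intro ε hε
  obtain ⟨i, hi⟩ := (TopologicalSpace.denseRange_denseSeq K).exists_dist_lt z (ε := ε/4) (by linarith)
  have h1 : ∀ᶠ x' in nhds x, dist (H x' i) (H x i) < ε / 4 :=
    Metric.tendsto_nhds.1 ((continuous_apply i).comp hHc).continuousAt (ε/4) (by linarith)
  have h2 : ∀ᶠ z' in nhds z, dist z' z < ε / 4 := Metric.ball_mem_nhds _ (by linarith)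
  rw [nhds_prod_eq]
  filter_upwards [h1.prod_mk h2] with ⟨x', z'⟩ ⟨ha, hb⟩
  set w := TopologicalSpace.denseSeq K i
  simp only [H] at ha hb
  have k1 : dist (G (x', z')) (G (x', w)) ≤ dist z' w := (hGc _ _ _).trans (by nlinarith [dist_nonneg (x := z') (y := w)])
  have k2 : dist (G (x, w)) (G (x, z)) ≤ dist w z := (hGc _ _ _).trans (by nlinarith [dist_nonneg (x := w) (y := z)])
  have k3 := dist_triangle z' z w
  have k4 := dist_triangle (G (x', z')) (G (x', w)) (G (x, z))
  have k5 := dist_triangle (G (x', w)) (G (x, w)) (G (x, z))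
  rw [dist_comm w z] at k2
  change dist z' z < ε/4 at hb
  change dist (G (x', w)) (G (x, w)) < ε/4 at ha
  linarith

lemma jordan_toSM {X : Type*} [MeasurableSpace X] (μ : Measure X) [IsFiniteMeasure μ] :
    (toSM μ).toJordanDecomposition = ⟨μ, 0, Measure.MutuallySingular.zero_right⟩ := by
  apply SignedMeasure.toJordanDecomposition_eq
  rw [toSM, dif_pos (inferInstance : IsFiniteMeasure μ), JordanDecomposition.toSignedMeasure]
  simp

lemma wNorm_le_one {K : Type*} [MetricSpace K] [MeasurableSpace K] (ζ : ℝ) (κ : Measure K)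
    [IsProbabilityMeasure κ] : wNorm ζ (toSM κ) ≤ 1 := by
  apply Real.sSup_le _ zero_le_one
  rintro _ ⟨g, hg, -, rfl⟩
  rw [sInt, jordan_toSM]
  simp only [integral_zero_measure, sub_zero]
  have := norm_integral_le_of_norm_le_const (μ := κ) (C := 1) (f := g)
    (Eventually.of_forall hg)
  simpa using this

lemma mem_of_marg {M K : Type*} [MetricSpace M] [CompactSpace M] [MeasurableSpace M] [BorelSpace M]
    [MetricSpace K] [CompactSpace K] [MeasurableSpace K] [BorelSpace K]
    [StandardBorelSpace K] [Nonempty K] (ζ : ℝ) (m₁ : Measure M) [IsProbabilityMeasure m₁]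
    (μ : Measure (M × K)) [IsProbabilityMeasure μ] (h : μ.fst = m₁) :
    memSinf ζ m₁ (toSM μ) := by
  have e1 : μ.fst.rnDeriv m₁ =ᵐ[m₁] fun _ => 1 := by
    rw [h]; exact Measure.rnDeriv_self m₁
  have e0 : (0 : Measure (M × K)).fst.rnDeriv m₁ =ᵐ[m₁] 0 := by
    rw [Measure.fst_zero]; exact Measure.rnDeriv_zero m₁
  have hs : ∀ᵐ γ ∂m₁, signedDensity m₁ (toSM μ) γ = 1 := by
    unfold signedDensity
    rw [jordan_toSM]
    filter_upwards [e1, e0] with γ h1 h0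
    rw [h1, h0]
    simp
  refine ⟨⟨?_, ?_, ?_⟩, fun _ => 1, ?_, ?_⟩
  · rw [jordan_toSM]
    simp only
    rw [h]
  · rw [jordan_toSM]
    simp only [Measure.fst_zero]
    exact Measure.AbsolutelyContinuous.zero m₁
  · refine lt_of_le_of_lt (b := 1) ?_ ENNReal.one_lt_top
    refine essSup_le_of_ae_le _ ?_
    have e1' : (toSM μ).toJordanDecomposition.posPart.fst.rnDeriv m₁ =ᵐ[m₁] fun _ => 1 := by
      rw [jordan_toSM]; exact e1
    have e0' : (toSM μ).toJordanDecomposition.negPart.fst.rnDeriv m₁ =ᵐ[m₁] 0 := by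
      rw [jordan_toSM]; exact e0
    filter_upwards [e1', e0'] with γ h1 h0
    simp only [fiberS, fiberPos]
    rw [h1, h0]
    simp only [ENNReal.toReal_one, one_smul, Pi.zero_apply, ENNReal.toReal_zero, zero_smul, sub_zero]
    rw [ENNReal.ofReal_le_one]
    exact wNorm_le_one ζ _
  · filter_upwards [hs] with γ hγ
    exact hγ.symm
  · simp [hC]

lemma hNormE_lt_top {M : Type*} [MetricSpace M] [CompactSpace M] [Nonempty M] (ζ : ℝ) (hζ0 : 0 < ζ)
    (hdM : Metric.diam (Set.univ : Set M) ≤ 1) (φ : M → ℝ) (h : hC ζ φ < ⊤) :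
    hNormE ζ φ < ⊤ := by
  rw [hNormE, ENNReal.add_lt_top]
  refine ⟨?_, h⟩
  obtain ⟨x0⟩ := (inferInstance : Nonempty M)
  refine lt_of_le_of_lt (b := ENNReal.ofReal (|φ x0| + (hC ζ φ).toReal)) ?_ ENNReal.ofReal_lt_top
  refine iSup_le fun x => ENNReal.ofReal_le_ofReal ?_
  by_cases hx : x = x0
  · subst hx; simp
  have h1 : ENNReal.ofReal (|φ x - φ x0| / dist x x0 ^ ζ) ≤ hC ζ φ :=
    le_iSup₂_of_le x x0 (le_iSup_of_le hx le_rfl)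
  have hd : dist x x0 ≤ 1 := (Metric.dist_le_diam_of_mem
      (isCompact_univ.isBounded) (Set.mem_univ _) (Set.mem_univ _)).trans hdM
  have hp : 0 < dist x x0 := dist_pos.2 hx
  have h2 := (ENNReal.ofReal_le_iff_le_toReal h.ne).1 h1
  rw [div_le_iff₀ (Real.rpow_pos_of_pos hp _)] at h2
  have h3 : dist x x0 ^ ζ ≤ 1 := Real.rpow_le_one hp.le hd hζ0.le
  have h4 := abs_sub_abs_le_abs_sub (φ x) (φ x0)
  have h5 : 0 ≤ (hC ζ φ).toReal := ENNReal.toReal_nonneg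
  nlinarith

lemma Pf_congr {X : Type*} [MeasurableSpace X] (m : Measure X) (f : X → X) (φ ψ : X → ℝ)
    (h : φ =ᵐ[m] ψ) : Pf m f φ = Pf m f ψ := by
  unfold Pf
  have e1 : m.withDensity (fun x => ENNReal.ofReal (φ x)) =
      m.withDensity (fun x => ENNReal.ofReal (ψ x)) :=
    withDensity_congr_ae (by filter_upwards [h] with x hx; rw [hx])
  have e2 : m.withDensity (fun x => ENNReal.ofReal (-φ x)) =
      m.withDensity (fun x => ENNReal.ofReal (-ψ x)) :=
    withDensity_congr_ae (by filter_upwards [h] with x hx; rw [hx])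
  rw [e1, e2]

lemma Pf_fix {X : Type*} [MeasurableSpace X] (m ν : Measure X) [IsProbabilityMeasure m]
    [IsProbabilityMeasure ν] (f : X → X) (hf : Measurable f) (hm : m.map f = m) (hν : ν.map f = ν)
    (hac : ν ≪ m) (φ : X → ℝ) (hφ : φ =ᵐ[m] fun x => (ν.rnDeriv m x).toReal) :
    Pf m f (fun x => φ x - 1) =ᵐ[m] fun x => φ x - 1 := by
  have hi : Integrable φ m := Measure.integrable_toReal_rnDeriv.congr hφ.symm
  have hψ : Integrable (fun x => φ x - 1) m := hi.sub (integrable_const 1)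
  have f1 : IsFiniteMeasure (m.withDensity fun x => ENNReal.ofReal (φ x - 1)) :=
    isFiniteMeasure_withDensity_ofReal hψ.2
  have f2 : IsFiniteMeasure (m.withDensity fun x => ENNReal.ofReal (-(φ x - 1))) :=
    isFiniteMeasure_withDensity_ofReal hψ.neg.2
  have key : (m.withDensity fun x => ENNReal.ofReal (φ x - 1)) + m =
      (m.withDensity fun x => ENNReal.ofReal (-(φ x - 1))) + ν := by
    conv_rhs => rw [← Measure.withDensity_rnDeriv_eq ν m hac]
    have e : (m.withDensity fun x => ENNReal.ofReal (φ x - 1)) + m =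
        (m.withDensity fun x => ENNReal.ofReal (φ x - 1)) + m.withDensity 1 := by
      rw [withDensity_one]
    rw [e, ← withDensity_add_right _ measurable_one,
      ← withDensity_add_right _ (Measure.measurable_rnDeriv ν m)]
    apply withDensity_congr_ae
    filter_upwards [hφ, Measure.rnDeriv_ne_top ν m] with x h0 h1
    simp only [Pi.add_apply, Pi.one_apply]
    have hp : 0 ≤ φ x := by rw [h0]; exact ENNReal.toReal_nonneg
    rw [← ENNReal.ofReal_toReal h1, ← h0, ← ENNReal.ofReal_one]
    rcases le_total 1 (φ x) with h | h
    · rw [ENNReal.ofReal_of_nonpos (p := -(φ x - 1)) (by linarith), zero_add,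
        ← ENNReal.ofReal_add (by linarith) zero_le_one]
      congr 1; ring
    · rw [ENNReal.ofReal_of_nonpos (p := (φ x - 1)) (by linarith), zero_add,
        ← ENNReal.ofReal_add (by linarith) hp]
      congr 1; ring
  have key2 := congrArg (Measure.map f) key
  rw [Measure.map_add _ _ hf, Measure.map_add _ _ hf, hm, hν] at key2
  have d1 := Measure.rnDeriv_add' ((m.withDensity fun x => ENNReal.ofReal (φ x - 1)).map f) m m
  have d2 := Measure.rnDeriv_add' ((m.withDensity fun x => ENNReal.ofReal (-(φ x - 1))).map f) ν m
  rw [key2] at d1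
  filter_upwards [hφ, d1, d2, Measure.rnDeriv_self m, Measure.rnDeriv_ne_top ν m,
    Measure.rnDeriv_ne_top ((m.withDensity fun x => ENNReal.ofReal (φ x - 1)).map f) m,
    Measure.rnDeriv_ne_top ((m.withDensity fun x => ENNReal.ofReal (-(φ x - 1))).map f) m]
    with x h0 h1 h2 h3 h4 h5 h6
  rw [h1] at h2
  simp only [Pi.add_apply, h3] at h2
  have := congrArg ENNReal.toReal h2
  rw [ENNReal.toReal_add h5 ENNReal.one_ne_top, ENNReal.toReal_add h6 h4, ← h0] at this
  simp only [ENNReal.toReal_one] at this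
  simp only [Pf]
  linarith

lemma marg_eq {M : Type*}
    [MetricSpace M] [CompactSpace M] [MeasurableSpace M] [BorelSpace M]
    (ζ : ℝ) (hζ0 : 0 < ζ) (hdM : Metric.diam (Set.univ : Set M) ≤ 1)
    (m₁ : Measure M) [IsProbabilityMeasure m₁]
    (f : M → M) (hf : Measurable f) (hfinv : m₁.map f = m₁)
    (D r : ℝ) (hr0 : 0 < r) (hr1 : r < 1)
    (hgap : ∀ φ : M → ℝ, hC ζ φ < ⊤ → ∫ x, φ x ∂m₁ = 0 → ∀ n : ℕ, 1 ≤ n →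
      ∃ ψ : M → ℝ, ψ =ᵐ[m₁] (Pf m₁ f)^[n] φ ∧
        hNormE ζ ψ ≤ ENNReal.ofReal (D * r ^ n) * hNormE ζ φ)
    (ν : Measure M) [IsProbabilityMeasure ν] (hac : ν ≪ m₁) (hν : ν.map f = ν)
    (φ : M → ℝ) (hφ : φ =ᵐ[m₁] fun x => (ν.rnDeriv m₁ x).toReal) (hφC : hC ζ φ < ⊤) :
    ν = m₁ := by
  have : Nonempty M := nonempty_of_isProbabilityMeasure m₁
  set ψ : M → ℝ := fun x => φ x - 1 with hψ
  have hψC : hC ζ ψ < ⊤ := by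
    have : hC ζ ψ = hC ζ φ := by simp [hC, hψ]
    rwa [this]
  have hi : Integrable φ m₁ := Measure.integrable_toReal_rnDeriv.congr hφ.symm
  have hint : ∫ x, ψ x ∂m₁ = 0 := by
    simp only [hψ]
    rw [integral_sub hi (integrable_const 1), integral_congr_ae hφ, Measure.integral_toReal_rnDeriv hac]
    simp
  have hfix := Pf_fix m₁ ν f hf hfinv hν hac φ hφ
  have hit : ∀ n : ℕ, (Pf m₁ f)^[n] ψ =ᵐ[m₁] ψ := by
    intro n
    induction n with
    | zero => exact Filter.EventuallyEq.rfl
    | succ n ih =>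
      rw [Function.iterate_succ_apply', Pf_congr m₁ f _ _ ih]
      exact hfix
  have hfin := hNormE_lt_top ζ hζ0 hdM ψ hψC
  have hb : ∀ n : ℕ, ∀ᵐ x ∂m₁, ENNReal.ofReal |ψ x| ≤
      ENNReal.ofReal (D * r ^ (n+1)) * hNormE ζ ψ := by
    intro n
    obtain ⟨χ, h1, h2⟩ := hgap ψ hψC hint (n+1) (by omega)
    filter_upwards [h1, hit (n+1)] with x hx1 hx2
    rw [← hx2, ← hx1]
    refine le_trans ?_ h2
    exact (le_iSup (fun x => ENNReal.ofReal |χ x|) x).trans le_self_add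
  have hlim : Tendsto (fun n : ℕ => ENNReal.ofReal (D * r ^ (n+1)) * hNormE ζ ψ) atTop (nhds 0) := by
    have t1 : Tendsto (fun n : ℕ => D * r ^ (n+1)) atTop (nhds 0) := by
      simpa using ((tendsto_pow_atTop_nhds_zero_of_lt_one hr0.le hr1).comp
        (tendsto_add_atTop_nat 1)).const_mul D
    have t2 := ENNReal.Tendsto.mul_const (ENNReal.tendsto_ofReal t1) (b := hNormE ζ ψ)
      (Or.inr hfin.ne)
    simpa using t2
  have hz : ∀ᵐ x ∂m₁, φ x = 1 := by
    filter_upwards [ae_all_iff.2 hb] with x hx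
    have := ge_of_tendsto' hlim hx
    have h0 : |ψ x| ≤ 0 := by simpa using this
    have := abs_nonpos_iff.1 h0
    simp only [hψ] at this
    linarith
  rw [← Measure.withDensity_rnDeriv_eq ν m₁ hac]
  conv_rhs => rw [← withDensity_one (μ := m₁)]
  apply withDensity_congr_ae
  filter_upwards [hz, hφ, Measure.rnDeriv_ne_top ν m₁] with x h1 h2 h3
  rw [← ENNReal.ofReal_toReal h3, ← h2, h1]
  simp

/-- **Theorem A.** Under the spectral gap property for `P_f`, the skew product
`F(x,z) = (f(x), G(x,z))` with uniformly contracting fibers has exactly one invariant Borel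
probability measure `μ₀` in `S^∞`; moreover `π_{x*}μ₀ = m₁`. -/
theorem exists_unique_invariant_measure_Sinf {M K : Type*}
    [MetricSpace M] [CompactSpace M] [MeasurableSpace M] [BorelSpace M]
    [MetricSpace K] [CompactSpace K] [MeasurableSpace K] [BorelSpace K]
    [StandardBorelSpace K] [Nonempty K]
    (ζ : ℝ) (hζ0 : 0 < ζ) (hζ1 : ζ ≤ 1)
    (hdM : Metric.diam (Set.univ : Set M) ≤ 1) (hdK : Metric.diam (Set.univ : Set K) ≤ 1)
    (m₁ : Measure M) [IsProbabilityMeasure m₁]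
    (f : M → M) (hf : Measurable f) (hfinv : m₁.map f = m₁)
    (G : M × K → K) (hG : Measurable G)
    (α : ℝ) (hα0 : 0 < α) (hα1 : α < 1)
    (hGc : ∀ᵐ x ∂m₁, ∀ z₁ z₂ : K, dist (G (x, z₁)) (G (x, z₂)) ≤ α * dist z₁ z₂)
    (F : M × K → M × K) (hF : ∀ p, F p = (f p.1, G p))
    -- spectral gap for the transfer operator of `f`
    (D r : ℝ) (hD : 0 < D) (hr0 : 0 < r) (hr1 : r < 1)
    (hgap : ∀ φ : M → ℝ, hC ζ φ < ⊤ → ∫ x, φ x ∂m₁ = 0 → ∀ n : ℕ, 1 ≤ n →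
      ∃ ψ : M → ℝ, ψ =ᵐ[m₁] (Pf m₁ f)^[n] φ ∧
        hNormE ζ ψ ≤ ENNReal.ofReal (D * r ^ n) * hNormE ζ φ) :
    ∃ μ₀ : Measure (M × K), IsProbabilityMeasure μ₀ ∧ μ₀.map F = μ₀ ∧
      memSinf ζ m₁ (toSM μ₀) ∧
      (∀ μ' : Measure (M × K), IsProbabilityMeasure μ' → μ'.map F = μ' →
        memSinf ζ m₁ (toSM μ') → μ' = μ₀) ∧
      μ₀.map Prod.fst = m₁ := by
  obtain rfl : F = fun p => (f p.1, G p) := funext hF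
  classical
  obtain ⟨z0⟩ := (inferInstance : Nonempty K)
  set N := toMeasurable m₁ {x | ¬ ∀ z₁ z₂ : K, dist (G (x, z₁)) (G (x, z₂)) ≤ α * dist z₁ z₂}
    with hN
  have hNm : MeasurableSet N := measurableSet_toMeasurable _ _
  have hN0 : m₁ N = 0 := by rw [hN, measure_toMeasurable]; exact hGc
  let G' : M × K → K := fun p => if p.1 ∈ N then z0 else G p
  have hG' : Measurable G' := Measurable.ite (measurable_fst hNm) measurable_const hG
  have hGc' : ∀ x, ∀ z₁ z₂ : K, dist (G' (x, z₁)) (G' (x, z₂)) ≤ α * dist z₁ z₂ := by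
    intro x z₁ z₂
    by_cases hx : x ∈ N
    · simp only [G', hx, if_true, dist_self]
      positivity
    · simp only [G', hx, if_false]
      by_contra hc
      exact hx (subset_toMeasurable m₁ _ (fun h => hc (h z₁ z₂)))
  have hFF : ∀ ρ : Measure (M × K), ρ.map Prod.fst = m₁ →
      ρ.map (fun p : M × K => (f p.1, G p)) = ρ.map (fun p : M × K => (f p.1, G' p)) := by
    intro ρ hρ
    apply Measure.map_congr
    have h0 : ρ (Prod.fst ⁻¹' N) = 0 := by
      rw [← Measure.map_apply measurable_fst hNm, hρ, hN0]
    have h1 : ∀ᵐ p ∂ρ, p ∉ Prod.fst ⁻¹' N := measure_eq_zero_iff_ae_notMem.1 h0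
    filter_upwards [h1] with p hp
    have : p.1 ∉ N := hp
    simp only [G', this, if_false]
  obtain ⟨μ₀, hp, hi, hm⟩ := exists_inv hdK m₁ f hf hfinv G' hG' α hα0 hα1 hGc'
  refine ⟨μ₀, hp, (hFF μ₀ hm).trans hi, mem_of_marg ζ m₁ μ₀ hm, ?_, hm⟩
  intro μ' hp' hi' hmem
  obtain ⟨⟨hac, -, -⟩, φ, hφ, hφC⟩ := hmem
  have hFm : Measurable (fun p : M × K => (f p.1, G p)) := (hf.comp measurable_fst).prodMk hG
  have hm' : μ'.map Prod.fst = m₁ := by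
    rw [jordan_toSM] at hac
    have hφ' : φ =ᵐ[m₁] fun x => (μ'.fst.rnDeriv m₁ x).toReal := by
      refine hφ.trans ?_
      have e0 : (0 : Measure (M × K)).fst.rnDeriv m₁ =ᵐ[m₁] 0 := by
        rw [Measure.fst_zero]; exact Measure.rnDeriv_zero m₁
      unfold signedDensity
      rw [jordan_toSM]
      filter_upwards [e0] with γ h0
      rw [h0]
      simp
    refine marg_eq ζ hζ0 hdM m₁ f hf hfinv D r hr0 hr1 hgap μ'.fst hac ?_ φ hφ' hφC
    rw [Measure.fst, Measure.map_map hf measurable_fst]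
    conv_rhs => rw [← hi', Measure.map_map measurable_fst hFm]
    rfl
  exact unique_inv hdK m₁ f hf G' hG' α hα0 hα1 hGc' μ' μ₀ hm' hm
    ((hFF μ' hm').symm.trans hi') hi
end

section
/- (Exponential convergence to equilibrium.) Set β₁ := max{ r^{1/2}, (α^ζ)^{1/2} } and D* := (α^ζ)^{-1/2} + D·(1−α^ζ)^{-1}·r^{-1/2}. Then for every signed measure μ ∈ S^∞ with μ(Σ) = 0 and every n ≥ 1: ‖F_*^n μ‖_∞ ≤ D*·β₁^n·‖μ‖_{S^∞}. -/
open MeasureTheory ProbabilityTheory Filter ENNReal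

section Helpers

set_option linter.unusedSectionVars false
set_option linter.unusedVariables false

lemma hx_jord {X : Type*} [MeasurableSpace X] (ν : SignedMeasure X) (ν1 ν2 : Measure X)
    [IsFiniteMeasure ν1] [IsFiniteMeasure ν2]
    (h : ∀ s, MeasurableSet s → ν s = ν1.real s - ν2.real s) :
    ν.toJordanDecomposition.posPart + ν2 = ν.toJordanDecomposition.negPart + ν1 := by
  ext s hs
  have h1 := h s hs
  rw [SignedMeasure.apply_eq_posPart_real_sub_negPart_real ν hs] at h1
  have h2 : (ν.toJordanDecomposition.posPart + ν2).real s
      = (ν.toJordanDecomposition.negPart + ν1).real s := by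
    rw [measureReal_add_apply, measureReal_add_apply]; linarith
  exact (measureReal_eq_measureReal_iff).1 h2

lemma hx_integrable {X : Type*} [MeasurableSpace X] (ν : Measure X) [IsFiniteMeasure ν]
    {g : X → ℝ} (hg : Measurable g) {C : ℝ} (hC : ∀ x, |g x| ≤ C) : Integrable g ν :=
  Integrable.of_bound hg.aestronglyMeasurable C (Eventually.of_forall hC)

lemma hx_sInt {X : Type*} [MeasurableSpace X] (ν : SignedMeasure X) (ν1 ν2 : Measure X)
    [IsFiniteMeasure ν1] [IsFiniteMeasure ν2]
    (h : ∀ s, MeasurableSet s → ν s = ν1.real s - ν2.real s)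
    {g : X → ℝ} (hg : Measurable g) {C : ℝ} (hC : ∀ x, |g x| ≤ C) :
    sInt ν g = ∫ x, g x ∂ν1 - ∫ x, g x ∂ν2 := by
  have h1 := congrArg (fun m => ∫ x, g x ∂m) (hx_jord ν ν1 ν2 h)
  beta_reduce at h1
  rw [integral_add_measure (hx_integrable _ hg hC) (hx_integrable _ hg hC),
    integral_add_measure (hx_integrable _ hg hC) (hx_integrable _ hg hC)] at h1
  unfold sInt
  linarith

variable {M : Type*} {K : Type*}
variable [MetricSpace M] [CompactSpace M] [MeasurableSpace M] [BorelSpace M]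
variable [MetricSpace K] [CompactSpace K] [MeasurableSpace K] [BorelSpace K]
variable [StandardBorelSpace K] [Nonempty K]

/-- unnormalised fibre integral of a positive measure -/
noncomputable def hxI (m₁ : Measure M) (ρ : Measure (M × K)) [IsFiniteMeasure ρ]
    (h : M × K → ℝ) (γ : M) : ℝ :=
  (ρ.fst.rnDeriv m₁ γ).toReal * ∫ z, h (γ, z) ∂ρ.condKernel γ

lemma hxI_integrable (m₁ : Measure M) [IsProbabilityMeasure m₁] (ρ : Measure (M × K))
    [IsFiniteMeasure ρ] {h : M × K → ℝ} (hh : Measurable h) {C : ℝ} (hC : ∀ x, |h x| ≤ C) :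
    Integrable (hxI m₁ ρ h) m₁ := by
  unfold hxI
  refine Integrable.mul_bdd (c := C) Measure.integrable_toReal_rnDeriv ?_ ?_
  · exact (StronglyMeasurable.integral_kernel_prod_right' (f := h)
      (κ := ρ.condKernel) hh.stronglyMeasurable).aestronglyMeasurable
  · refine Eventually.of_forall fun γ => ?_
    refine (norm_integral_le_of_norm_le_const (C := C) (Eventually.of_forall fun z => hC _)).trans ?_
    simp

lemma hxI_set (m₁ : Measure M) [IsProbabilityMeasure m₁] (ρ : Measure (M × K))
    [IsFiniteMeasure ρ] (hac : ρ.fst ≪ m₁)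
    {h : M × K → ℝ} (hh : Measurable h) {C : ℝ} (hC : ∀ x, |h x| ≤ C)
    {A : Set M} (hA : MeasurableSet A) :
    ∫ γ in A, hxI m₁ ρ h γ ∂m₁ = ∫ p, (A ×ˢ Set.univ).indicator h p ∂ρ := by
  unfold hxI
  have := setIntegral_rnDeriv_smul (μ := ρ.fst) (ν := m₁)
    (f := fun γ => ∫ z, h (γ, z) ∂ρ.condKernel γ) hac hA
  simp only [smul_eq_mul] at this
  rw [this, Measure.setIntegral_condKernel_univ_right hA (hx_integrable _ hh hC).integrableOn,
    integral_indicator (hA.prod MeasurableSet.univ)]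

lemma hx_fiberPos (m₁ : Measure M) (ρ : Measure (M × K)) [IsFiniteMeasure ρ] (γ : M) :
    ∀ s, MeasurableSet s → fiberPos m₁ ρ γ s
      = ((ρ.fst.rnDeriv m₁ γ).toNNReal • ρ.condKernel γ).real s := by
  intro s hs
  unfold fiberPos toSM
  rw [dif_pos (show IsFiniteMeasure (ρ.condKernel γ) from inferInstance)]
  rw [_root_.smul_apply, Measure.toSignedMeasure_apply_measurable hs, measureReal_nnreal_smul_apply]
  rfl

lemma hx_fiberS (m₁ : Measure M) (μ : SignedMeasure (M × K)) (γ : M)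
    {g : K → ℝ} (hg : Measurable g) {C : ℝ} (hC : ∀ x, |g x| ≤ C) :
    sInt (fiberS m₁ μ γ) g =
      hxI m₁ μ.toJordanDecomposition.posPart (fun p => g p.2) γ
      - hxI m₁ μ.toJordanDecomposition.negPart (fun p => g p.2) γ := by
  rw [hx_sInt (fiberS m₁ μ γ)
    ((μ.toJordanDecomposition.posPart.fst.rnDeriv m₁ γ).toNNReal •
      μ.toJordanDecomposition.posPart.condKernel γ)
    ((μ.toJordanDecomposition.negPart.fst.rnDeriv m₁ γ).toNNReal •
      μ.toJordanDecomposition.negPart.condKernel γ) ?_ hg hC]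
  · rw [integral_smul_nnreal_measure, integral_smul_nnreal_measure]
    rfl
  · intro s hs
    rw [← hx_fiberPos m₁ _ γ s hs, ← hx_fiberPos m₁ _ γ s hs]
    rfl

/-- fibrewise version -/
lemma hx_fiberS' (m₁ : Measure M) (μ : SignedMeasure (M × K)) (γ : M)
    {h : M × K → ℝ} (hh : Measurable h) {C : ℝ} (hC : ∀ x, |h x| ≤ C) :
    sInt (fiberS m₁ μ γ) (fun z => h (γ, z)) =
      hxI m₁ μ.toJordanDecomposition.posPart h γ
      - hxI m₁ μ.toJordanDecomposition.negPart h γ :=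
  hx_fiberS m₁ μ γ (hh.comp measurable_prodMk_left) (fun z => hC _)

/-- marginals are absolutely continuous -/
def hxAC (m₁ : Measure M) (μ : SignedMeasure (M × K)) : Prop :=
  μ.toJordanDecomposition.posPart.fst ≪ m₁ ∧ μ.toJordanDecomposition.negPart.fst ≪ m₁

lemma hx_J_integrable (m₁ : Measure M) [IsProbabilityMeasure m₁] (μ : SignedMeasure (M × K))
    {h : M × K → ℝ} (hh : Measurable h) {C : ℝ} (hC : ∀ x, |h x| ≤ C) :
    Integrable (fun γ => sInt (fiberS m₁ μ γ) (fun z => h (γ, z))) m₁ := by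
  simp only [hx_fiberS' m₁ μ _ hh hC]
  exact (hxI_integrable _ _ hh hC).sub (hxI_integrable _ _ hh hC)

lemma hx_J_set (m₁ : Measure M) [IsProbabilityMeasure m₁] (μ : SignedMeasure (M × K))
    (hac : hxAC m₁ μ)
    {h : M × K → ℝ} (hh : Measurable h) {C : ℝ} (hC : ∀ x, |h x| ≤ C)
    {A : Set M} (hA : MeasurableSet A) :
    ∫ γ in A, sInt (fiberS m₁ μ γ) (fun z => h (γ, z)) ∂m₁
      = sInt μ ((A ×ˢ Set.univ).indicator h) := by
  simp only [hx_fiberS' m₁ μ _ hh hC]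
  rw [integral_sub (hxI_integrable _ _ hh hC).integrableOn (hxI_integrable _ _ hh hC).integrableOn,
    hxI_set m₁ _ hac.1 hh hC hA, hxI_set m₁ _ hac.2 hh hC hA]
  rfl

lemma hx_map_apply {X : Type*} [MeasurableSpace X] (μ : SignedMeasure X) {T : X → X}
    (hT : Measurable T) : ∀ s, MeasurableSet s → μ.map T s =
      (μ.toJordanDecomposition.posPart.map T).real s
        - (μ.toJordanDecomposition.negPart.map T).real s := by
  intro s hs
  rw [VectorMeasure.map_apply _ hT hs,
    SignedMeasure.apply_eq_posPart_real_sub_negPart_real μ (hT hs),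
    map_measureReal_apply hT hs, map_measureReal_apply hT hs]

lemma hx_sInt_map {X : Type*} [MeasurableSpace X] (μ : SignedMeasure X) {T : X → X}
    (hT : Measurable T) {g : X → ℝ} (hg : Measurable g) {C : ℝ} (hC : ∀ x, |g x| ≤ C) :
    sInt (μ.map T) g = sInt μ (g ∘ T) := by
  rw [hx_sInt (μ.map T) _ _ (hx_map_apply μ hT) hg hC, integral_map hT.aemeasurable
    hg.aestronglyMeasurable, integral_map hT.aemeasurable hg.aestronglyMeasurable]
  rfl

lemma hx_null {X : Type*} [MeasurableSpace X] (ν : SignedMeasure X) (ν1 ν2 : Measure X)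
    [IsFiniteMeasure ν1] [IsFiniteMeasure ν2]
    (h : ∀ s, MeasurableSet s → ν s = ν1.real s - ν2.real s) {B : Set X} (hB : MeasurableSet B)
    (h1 : ν1 B = 0) (h2 : ν2 B = 0) :
    ν.toJordanDecomposition.posPart B = 0 ∧ ν.toJordanDecomposition.negPart B = 0 := by
  have hj := hx_jord ν ν1 ν2 h
  obtain ⟨S, hS, hp, hn⟩ := ν.toJordanDecomposition.mutuallySingular
  constructor
  · have e := congrArg (fun m => m (B ∩ Sᶜ)) hj
    simp only [Measure.add_apply] at e
    rw [measure_mono_null Set.inter_subset_right hn, measure_mono_null Set.inter_subset_left h1,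
      measure_mono_null Set.inter_subset_left h2] at e
    rw [← measure_inter_add_sdiff B hS, measure_mono_null Set.inter_subset_right hp, Set.sdiff_eq]
    simpa using e
  · have e := congrArg (fun m => m (B ∩ S)) hj
    simp only [Measure.add_apply] at e
    rw [measure_mono_null Set.inter_subset_right hp, measure_mono_null Set.inter_subset_left h1,
      measure_mono_null Set.inter_subset_left h2] at e
    rw [← measure_inter_add_sdiff B hS, Set.sdiff_eq, measure_mono_null Set.inter_subset_right hn]
    simpa using e.symm

lemma hx_AC_map (m₁ : Measure M) (μ : SignedMeasure (M × K)) (hac : hxAC m₁ μ)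
    {f : M → M} (hf : Measurable f) (hfinv : m₁.map f = m₁)
    {T : M × K → M × K} (hT : Measurable T) (hTf : ∀ p, (T p).1 = f p.1) :
    hxAC m₁ (μ.map T) := by
  have key : ∀ A, MeasurableSet A → m₁ A = 0 →
      (SignedMeasure.toJordanDecomposition (μ.map T)).posPart (Prod.fst ⁻¹' A) = 0 ∧
      (SignedMeasure.toJordanDecomposition (μ.map T)).negPart (Prod.fst ⁻¹' A) = 0 := by
    intro A hA h0
    have h0' : m₁ (f ⁻¹' A) = 0 := by rw [← Measure.map_apply hf hA, hfinv, h0]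
    have e : T ⁻¹' (Prod.fst ⁻¹' A) = Prod.fst ⁻¹' (f ⁻¹' A) := by
      ext p; simp [hTf]
    apply hx_null (μ.map T) _ _ (hx_map_apply μ hT) (measurable_fst hA)
    · rw [Measure.map_apply hT (measurable_fst hA), e, ← Measure.fst_apply (hf hA)]
      exact hac.1 h0'
    · rw [Measure.map_apply hT (measurable_fst hA), e, ← Measure.fst_apply (hf hA)]
      exact hac.2 h0'
  constructor
  · refine Measure.AbsolutelyContinuous.mk fun A hA h0 => ?_
    rw [Measure.fst_apply hA]; exact (key A hA h0).1
  · refine Measure.AbsolutelyContinuous.mk fun A hA h0 => ?_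
    rw [Measure.fst_apply hA]; exact (key A hA h0).2

lemma hx_sd (m₁ : Measure M) (μ : SignedMeasure (M × K)) (γ : M) :
    signedDensity m₁ μ γ = sInt (fiberS m₁ μ γ) (fun _ => 1) := by
  rw [hx_fiberS m₁ μ γ measurable_const (C := 1) (by simp)]
  simp [hxI, signedDensity]

/-- change of variables on fibres -/
lemma hx_J_map (m₁ : Measure M) [IsProbabilityMeasure m₁] (μ : SignedMeasure (M × K))
    (hac : hxAC m₁ μ)
    {f : M → M} (hf : Measurable f) (hfinv : m₁.map f = m₁)
    {T : M × K → M × K} (hT : Measurable T) (hTf : ∀ p, (T p).1 = f p.1)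
    {g : K → ℝ} (hg : Measurable g) {C : ℝ} (hC : ∀ x, |g x| ≤ C)
    {A : Set M} (hA : MeasurableSet A) :
    ∫ γ in A, sInt (fiberS m₁ (μ.map T) γ) g ∂m₁
      = ∫ γ in f ⁻¹' A, sInt (fiberS m₁ μ γ) (fun z => g (T (γ, z)).2) ∂m₁ := by
  have hg2 : Measurable (fun p : M × K => g p.2) := hg.comp measurable_snd
  rw [hx_J_set m₁ (μ.map T) (hx_AC_map m₁ μ hac hf hfinv hT hTf) (h := fun p => g p.2)
    hg2 (C := C) (fun _ => hC _) hA,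
    hx_J_set m₁ μ hac (h := fun p => g (T p).2) (hg2.comp hT) (C := C) (fun _ => hC _) (hf hA),
    hx_sInt_map μ hT (hg2.indicator (hA.prod MeasurableSet.univ)) (C := C)]
  · congr 1
    ext p
    have e : T p ∈ A ×ˢ (Set.univ : Set K) ↔ p ∈ (f ⁻¹' A) ×ˢ (Set.univ : Set K) := by
      simp [Set.mem_prod, hTf]
    by_cases hp : p ∈ (f ⁻¹' A) ×ˢ (Set.univ : Set K)
    · rw [Set.indicator_of_mem hp, Function.comp_apply, Set.indicator_of_mem (e.2 hp)]
    · rw [Set.indicator_of_notMem hp, Function.comp_apply,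
        Set.indicator_of_notMem (fun h => hp (e.1 h))]
  · intro p
    rw [Set.indicator]
    split_ifs
    · exact hC _
    · simpa using (abs_nonneg _).trans (hC p.2)

lemma hx_Pf_fin {X : Type*} [MeasurableSpace X] (m₁ : Measure X) [IsProbabilityMeasure m₁]
    {f : X → X} (hf : Measurable f) (hfinv : m₁.map f = m₁) {ψ : X → ℝ} (hψ : Integrable ψ m₁) :
    IsFiniteMeasure ((m₁.withDensity fun x => ENNReal.ofReal (ψ x)).map f) ∧
    (m₁.withDensity fun x => ENNReal.ofReal (ψ x)).map f ≪ m₁ := by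
  have h1 : IsFiniteMeasure (m₁.withDensity fun x => ENNReal.ofReal (ψ x)) :=
    isFiniteMeasure_withDensity_ofReal hψ.2
  refine ⟨inferInstance, ?_⟩
  have := (withDensity_absolutelyContinuous m₁ (fun x => ENNReal.ofReal (ψ x))).map hf
  rwa [hfinv] at this

lemma hx_Pf_int {X : Type*} [MeasurableSpace X] (m₁ : Measure X)
    (f : X → X) {ψ : X → ℝ} [IsFiniteMeasure m₁] (hf : Measurable f) (hψ : Integrable ψ m₁) :
    Integrable (Pf m₁ f ψ) m₁ := by
  have h1 : IsFiniteMeasure (m₁.withDensity fun x => ENNReal.ofReal (ψ x)) :=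
    isFiniteMeasure_withDensity_ofReal hψ.2
  have h2 : IsFiniteMeasure (m₁.withDensity fun x => ENNReal.ofReal (-ψ x)) :=
    isFiniteMeasure_withDensity_ofReal hψ.neg.2
  exact Measure.integrable_toReal_rnDeriv.sub Measure.integrable_toReal_rnDeriv

lemma hx_Pf_set {X : Type*} [MeasurableSpace X] (m₁ : Measure X) [IsProbabilityMeasure m₁]
    {f : X → X} (hf : Measurable f) (hfinv : m₁.map f = m₁) {ψ : X → ℝ} (hψ : Integrable ψ m₁)
    {A : Set X} (hA : MeasurableSet A) :
    ∫ γ in A, Pf m₁ f ψ γ ∂m₁ = ∫ γ in f ⁻¹' A, ψ γ ∂m₁ := by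
  obtain ⟨i1, ac1⟩ := hx_Pf_fin m₁ hf hfinv hψ
  obtain ⟨i2, ac2⟩ := hx_Pf_fin m₁ hf hfinv hψ.neg
  simp only [Pi.neg_apply] at i2 ac2
  unfold Pf
  rw [integral_sub Measure.integrable_toReal_rnDeriv.integrableOn
    Measure.integrable_toReal_rnDeriv.integrableOn,
    Measure.setIntegral_toReal_rnDeriv ac1, Measure.setIntegral_toReal_rnDeriv ac2,
    map_measureReal_apply hf hA, map_measureReal_apply hf hA,
    integral_eq_lintegral_pos_part_sub_lintegral_neg_part hψ.integrableOn,
    measureReal_def, measureReal_def, withDensity_apply _ (hf hA), withDensity_apply _ (hf hA)]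

lemma hx_sd_int (m₁ : Measure M) [IsProbabilityMeasure m₁] (μ : SignedMeasure (M × K)) :
    Integrable (signedDensity m₁ μ) m₁ :=
  Measure.integrable_toReal_rnDeriv.sub Measure.integrable_toReal_rnDeriv

lemma hx_sd_map (m₁ : Measure M) [IsProbabilityMeasure m₁] (μ : SignedMeasure (M × K))
    (hac : hxAC m₁ μ)
    {f : M → M} (hf : Measurable f) (hfinv : m₁.map f = m₁)
    {T : M × K → M × K} (hT : Measurable T) (hTf : ∀ p, (T p).1 = f p.1) :
    signedDensity m₁ (μ.map T) =ᵐ[m₁] Pf m₁ f (signedDensity m₁ μ) := by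
  refine Integrable.ae_eq_of_forall_setIntegral_eq _ _ (hx_sd_int m₁ _)
    (hx_Pf_int m₁ f hf (hx_sd_int m₁ _)) fun A hA _ => ?_
  rw [hx_Pf_set m₁ hf hfinv (hx_sd_int m₁ _) hA]
  simp only [hx_sd]
  exact hx_J_map m₁ μ hac hf hfinv hT hTf (g := fun _ => 1) measurable_const (C := 1) (by simp) hA

lemma hx_Pf_congr {X : Type*} [MeasurableSpace X] (m₁ : Measure X) (f : X → X) {φ ψ : X → ℝ}
    (h : φ =ᵐ[m₁] ψ) : Pf m₁ f φ = Pf m₁ f ψ := by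
  unfold Pf
  rw [withDensity_congr_ae (f := fun x => ENNReal.ofReal (φ x))
    (g := fun x => ENNReal.ofReal (ψ x)) (by filter_upwards [h] with x hx; rw [hx]),
    withDensity_congr_ae (f := fun x => ENNReal.ofReal (-φ x))
    (g := fun x => ENNReal.ofReal (-ψ x)) (by filter_upwards [h] with x hx; rw [hx])]

lemma hx_iter_fst {f : M → M} {T : M × K → M × K} (hTf : ∀ p, (T p).1 = f p.1) (n : ℕ) :
    ∀ p, (T^[n] p).1 = f^[n] p.1 := by
  induction n with
  | zero => simp
  | succ n ih => intro p; rw [Function.iterate_succ_apply', Function.iterate_succ_apply', hTf, ih]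

lemma hx_iter_inv {m₁ : Measure M} {f : M → M} (hf : Measurable f) (hfinv : m₁.map f = m₁)
    (n : ℕ) : m₁.map f^[n] = m₁ :=
  ((MeasurePreserving.mk hf hfinv).iterate n).map_eq

lemma hx_map_map {X : Type*} [MeasurableSpace X] (μ : SignedMeasure X) {T U : X → X}
    (hT : Measurable T) (hU : Measurable U) :
    VectorMeasure.map (VectorMeasure.map μ T) U = VectorMeasure.map μ (U ∘ T) := by
  ext s hs
  rw [VectorMeasure.map_apply _ hU hs, VectorMeasure.map_apply _ hT (hU hs),
    VectorMeasure.map_apply _ (hU.comp hT) hs, Set.preimage_comp]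

lemma hx_sd_iter (m₁ : Measure M) [IsProbabilityMeasure m₁] (μ : SignedMeasure (M × K))
    (hac : hxAC m₁ μ)
    {f : M → M} (hf : Measurable f) (hfinv : m₁.map f = m₁)
    {T : M × K → M × K} (hT : Measurable T) (hTf : ∀ p, (T p).1 = f p.1)
    {φ : M → ℝ} (hφ : φ =ᵐ[m₁] signedDensity m₁ μ) (n : ℕ) :
    signedDensity m₁ (μ.map T^[n]) =ᵐ[m₁] (Pf m₁ f)^[n] φ := by
  induction n with
  | zero =>
    simp only [Function.iterate_zero, VectorMeasure.map_id, id]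
    exact hφ.symm
  | succ n ih =>
    rw [Function.iterate_succ', ← hx_map_map μ (hT.iterate n) hT]
    refine (hx_sd_map m₁ (μ.map T^[n]) (hx_AC_map m₁ μ hac (hf.iterate n)
      (hx_iter_inv hf hfinv n) (hT.iterate n) (hx_iter_fst hTf n)) hf hfinv hT hTf).trans ?_
    rw [hx_Pf_congr m₁ f ih, Function.iterate_succ_apply']

/-- test functions -/
def hxT {X : Type*} [MetricSpace X] (ζ : ℝ) (g : X → ℝ) : Prop :=
  (∀ x, |g x| ≤ 1) ∧ (∀ x y, |g x - g y| ≤ dist x y ^ ζ)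

lemma hxT_cont {X : Type*} [MetricSpace X] {ζ : ℝ} (hζ : 0 < ζ) {g : X → ℝ} {c : ℝ}
    (hg : ∀ x y, |g x - g y| ≤ c * dist x y ^ ζ) : Continuous g := by
  rw [continuous_iff_continuousAt]
  intro x
  rw [ContinuousAt, tendsto_iff_dist_tendsto_zero]
  have h1 : Tendsto (fun y => c * dist y x ^ ζ) (nhds x) (nhds 0) := by
    have : Continuous (fun y => c * dist y x ^ ζ) :=
      continuous_const.mul ((continuous_id.dist continuous_const).rpow_const (fun _ => Or.inr hζ.le))
    have h := this.tendsto x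
    simpa [Real.zero_rpow hζ.ne'] using h
  refine squeeze_zero (fun _ => dist_nonneg) (fun y => ?_) h1
  rw [Real.dist_eq]; exact hg y x

lemma hx_bdd {X : Type*} [MetricSpace X] [MeasurableSpace X] (ν : SignedMeasure X)
    {g : X → ℝ} {C : ℝ} (hg : ∀ x, |g x| ≤ C) :
    |sInt ν g| ≤ C * (ν.toJordanDecomposition.posPart.real Set.univ
      + ν.toJordanDecomposition.negPart.real Set.univ) := by
  unfold sInt
  have h1 := norm_integral_le_of_norm_le_const (μ := ν.toJordanDecomposition.posPart)
    (f := g) (C := C) (Eventually.of_forall hg)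
  have h2 := norm_integral_le_of_norm_le_const (μ := ν.toJordanDecomposition.negPart)
    (f := g) (C := C) (Eventually.of_forall hg)
  refine (abs_sub _ _).trans ?_
  rw [Real.norm_eq_abs] at h1 h2
  linarith

lemma hx_le_wNorm {X : Type*} [MetricSpace X] [MeasurableSpace X] {ζ : ℝ} (ν : SignedMeasure X)
    {g : X → ℝ} (hg : hxT ζ g) : |sInt ν g| ≤ wNorm ζ ν := by
  refine le_csSup ⟨1 * (ν.toJordanDecomposition.posPart.real Set.univ
      + ν.toJordanDecomposition.negPart.real Set.univ), ?_⟩ ⟨g, hg.1, hg.2, rfl⟩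
  rintro _ ⟨g, h1, h2, rfl⟩
  exact hx_bdd ν h1

lemma hx_sInt_affine {X : Type*} [MetricSpace X] [MeasurableSpace X] (ν : SignedMeasure X)
    {g : X → ℝ} (hg : Measurable g) {C : ℝ} (hC : ∀ x, |g x| ≤ C) (a b : ℝ) :
    sInt ν (fun x => a * g x + b) = a * sInt ν g + b * sInt ν (fun _ => 1) := by
  unfold sInt
  have hi := fun (m : Measure X) [IsFiniteMeasure m] => (hx_integrable m hg hC).const_mul a
  rw [integral_add (hi _) (integrable_const _), integral_add (hi _) (integrable_const _),
    integral_const_mul, integral_const_mul]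
  simp
  ring

lemma hx_contr (hdK : Metric.diam (Set.univ : Set K) ≤ 1) {ζ : ℝ} (hζ : 0 < ζ)
    (ν : SignedMeasure K) {k : K → ℝ} (hk1 : ∀ x, |k x| ≤ 1) {c : ℝ} (hc : 0 < c)
    (hk2 : ∀ x y, |k x - k y| ≤ c * dist x y ^ ζ) :
    |sInt ν k| ≤ c * wNorm ζ ν + |sInt ν (fun _ => 1)| := by
  obtain ⟨z⟩ := ‹Nonempty K›
  have hd : ∀ x y : K, dist x y ^ ζ ≤ 1 := fun x y =>
    Real.rpow_le_one dist_nonneg ((Metric.dist_le_diam_of_mem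
      (isCompact_univ.isBounded) (Set.mem_univ x) (Set.mem_univ y)).trans hdK) hζ.le
  set k' : K → ℝ := fun x => (k x - k z) / c with hk'
  have ht : hxT ζ k' := by
    constructor
    · intro x
      rw [hk']; simp only
      rw [abs_div, abs_of_pos hc, div_le_one hc]
      refine (hk2 x z).trans ?_
      nlinarith [hd x z]
    · intro x y
      rw [hk']; simp only
      rw [← sub_div, abs_div, abs_of_pos hc, div_le_iff₀ hc, sub_sub_sub_cancel_right, mul_comm]
      exact hk2 x y
  have hm : Measurable k' := by
    have := (hxT_cont hζ hk2).measurable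
    exact (this.sub_const _).div_const _
  have e : k = fun x => c * k' x + k z := by
    ext x; rw [hk']; field_simp; ring
  rw [e, hx_sInt_affine ν hm ht.1]
  refine (abs_add_le _ _).trans ?_
  rw [abs_mul, abs_mul, abs_of_pos hc]
  refine add_le_add (mul_le_mul_of_nonneg_left (hx_le_wNorm ν ht) hc.le) ?_
  exact mul_le_of_le_one_left (abs_nonneg _) (hk1 z)

lemma hx_sInt_cont (ν : SignedMeasure K) : Continuous (fun g : C(K, ℝ) => sInt ν g) := by
  have h1 : ∀ (m : Measure K) [IsFiniteMeasure m], Continuous (fun g : C(K, ℝ) => ∫ x, g x ∂m) := by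
    intro m _
    have : LipschitzWith (m.real Set.univ).toNNReal (fun g : C(K, ℝ) => ∫ x, g x ∂m) := by
      refine LipschitzWith.of_dist_le_mul fun g h => ?_
      have hi : ∀ g : C(K, ℝ), Integrable g m := fun g =>
        hx_integrable m g.continuous.measurable (C := ‖g‖) (fun x => g.norm_coe_le_norm x)
      rw [Real.dist_eq, ← integral_sub (hi g) (hi h), Real.coe_toNNReal _ measureReal_nonneg,
        mul_comm, ← Real.norm_eq_abs]
      refine norm_integral_le_of_norm_le_const (μ := m) (Eventually.of_forall fun x => ?_)
      rw [← dist_eq_norm]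
      exact ContinuousMap.dist_apply_le_dist x
    exact this.continuous
  exact (h1 ν.toJordanDecomposition.posPart).sub (h1 ν.toJordanDecomposition.negPart)

lemma hx_avg {ζ : ℝ} (hζ : 0 < ζ) (m₁ : Measure M) [IsProbabilityMeasure m₁]
    (μ : SignedMeasure (M × K)) (hac : hxAC m₁ μ)
    {f : M → M} (hf : Measurable f) (hfinv : m₁.map f = m₁)
    {T : M × K → M × K} (hT : Measurable T) (hTf : ∀ p, (T p).1 = f p.1) {B : ℝ}
    (hB : ∀ g : K → ℝ, hxT ζ g →
      ∀ᵐ γ ∂m₁, |sInt (fiberS m₁ μ γ) (fun z => g (T (γ, z)).2)| ≤ B) :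
    ∀ᵐ γ ∂m₁, wNorm ζ (fiberS m₁ (μ.map T) γ) ≤ B := by
  have h1 : ∀ g : K → ℝ, hxT ζ g → ∀ᵐ γ ∂m₁, |sInt (fiberS m₁ (μ.map T) γ) g| ≤ B := by
    intro g hg
    have hgm : Measurable g :=
      (hxT_cont hζ (c := 1) (by simpa using hg.2)).measurable
    have i1 : Integrable (fun γ => sInt (fiberS m₁ (μ.map T) γ) g) m₁ :=
      hx_J_integrable m₁ (μ.map T) (h := fun p => g p.2) (hgm.comp measurable_snd) (C := 1)
        (fun p => hg.1 _)
    have i2 : Integrable (fun γ => sInt (fiberS m₁ μ γ) (fun z => g (T (γ, z)).2)) m₁ :=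
      hx_J_integrable m₁ μ (h := fun p => g (T p).2) ((hgm.comp measurable_snd).comp hT) (C := 1)
        (fun p => hg.1 _)
    have hmA : ∀ A, MeasurableSet A → m₁.real (f ⁻¹' A) = m₁.real A := fun A hA => by
      rw [← map_measureReal_apply hf hA, hfinv]
    have u : (fun γ => sInt (fiberS m₁ (μ.map T) γ) g) ≤ᵐ[m₁] fun _ => B := by
      refine ae_le_of_forall_setIntegral_le i1 (integrable_const _) fun A hA _ => ?_
      rw [hx_J_map m₁ μ hac hf hfinv hT hTf hgm hg.1 hA]
      refine (integral_mono_ae i2.integrableOn (integrable_const B) ?_).trans ?_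
      · filter_upwards [ae_restrict_of_ae (hB g hg)] with γ h using (abs_le.1 h).2
      · simp [hmA A hA]
    have l : (fun _ => -B) ≤ᵐ[m₁] (fun γ => sInt (fiberS m₁ (μ.map T) γ) g) := by
      refine ae_le_of_forall_setIntegral_le (integrable_const _) i1 fun A hA _ => ?_
      rw [hx_J_map m₁ μ hac hf hfinv hT hTf hgm hg.1 hA]
      refine le_trans ?_ (integral_mono_ae (integrable_const (-B)) i2.integrableOn ?_)
      · simp [hmA A hA]
      · filter_upwards [ae_restrict_of_ae (hB g hg)] with γ h using (abs_le.1 h).1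
    filter_upwards [u, l] with γ h1 h2 using abs_le.2 ⟨h2, h1⟩
  obtain ⟨t, hts, htc, htd⟩ := (TopologicalSpace.IsSeparable.of_separableSpace
    {g : C(K, ℝ) | hxT ζ g}).exists_countable_dense_subset
  have h2 : ∀ᵐ γ ∂m₁, ∀ g ∈ t, |sInt (fiberS m₁ (μ.map T) γ) g| ≤ B :=
    (ae_ball_iff htc).2 fun g hg => h1 g (hts hg)
  filter_upwards [h2] with γ hγ
  have hcl : IsClosed {g : C(K, ℝ) | |sInt (fiberS m₁ (μ.map T) γ) g| ≤ B} :=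
    isClosed_le (hx_sInt_cont _).abs continuous_const
  have hsub := htd.trans (closure_minimal (fun g hg => hγ g hg) hcl)
  refine csSup_le ⟨_, fun _ => 0, by simp, fun x y => by simp; positivity, rfl⟩ ?_
  rintro _ ⟨g, g1, g2, rfl⟩
  exact @hsub ⟨g, hxT_cont hζ (c := 1) (by simpa using g2)⟩ ⟨g1, g2⟩

lemma hx_main {ζ : ℝ} (hζ : 0 < ζ) (hdK : Metric.diam (Set.univ : Set K) ≤ 1)
    (m₁ : Measure M) [IsProbabilityMeasure m₁]
    (μ : SignedMeasure (M × K)) (hac : hxAC m₁ μ)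
    {f : M → M} (hf : Measurable f) (hfinv : m₁.map f = m₁)
    {T : M × K → M × K} (hT : Measurable T) (hTf : ∀ p, (T p).1 = f p.1)
    {α : ℝ} (hα0 : 0 < α) (hα1 : α ≤ 1)
    (hTc : ∀ᵐ x ∂m₁, ∀ z₁ z₂ : K, dist (T (x, z₁)).2 (T (x, z₂)).2 ≤ α * dist z₁ z₂)
    {a : ℝ} (ha : ∀ᵐ γ ∂m₁, wNorm ζ (fiberS m₁ μ γ) ≤ a) :
    (∀ᵐ γ ∂m₁, wNorm ζ (fiberS m₁ (μ.map T) γ) ≤ a) ∧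
    ∀ b : ℝ, (∀ᵐ γ ∂m₁, |signedDensity m₁ μ γ| ≤ b) →
      ∀ᵐ γ ∂m₁, wNorm ζ (fiberS m₁ (μ.map T) γ) ≤ α ^ ζ * a + b := by
  have hc : 0 < α ^ ζ := Real.rpow_pos_of_pos hα0 _
  have hc1 : α ^ ζ ≤ 1 := Real.rpow_le_one hα0.le hα1 hζ.le
  have key : ∀ g : K → ℝ, hxT ζ g → ∀ x : M,
      (∀ z₁ z₂ : K, dist (T (x, z₁)).2 (T (x, z₂)).2 ≤ α * dist z₁ z₂) →
      ∀ y z, |g (T (x, y)).2 - g (T (x, z)).2| ≤ α ^ ζ * dist y z ^ ζ := by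
    intro g hg x hx y z
    refine (hg.2 _ _).trans ?_
    rw [← Real.mul_rpow hα0.le dist_nonneg]
    exact Real.rpow_le_rpow dist_nonneg (hx y z) hζ.le
  constructor
  · refine hx_avg hζ m₁ μ hac hf hfinv hT hTf fun g hg => ?_
    filter_upwards [hTc, ha] with x hx hax
    refine (hx_le_wNorm _ ⟨fun z => hg.1 _, fun y z => (key g hg x hx y z).trans ?_⟩).trans hax
    exact mul_le_of_le_one_left (by positivity) hc1
  · intro b hb
    refine hx_avg hζ m₁ μ hac hf hfinv hT hTf fun g hg => ?_
    filter_upwards [hTc, ha, hb] with x hx hax hbx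
    rw [hx_sd] at hbx
    refine (hx_contr hdK hζ _ (fun z => hg.1 _) hc (key g hg x hx)).trans ?_
    exact add_le_add (mul_le_mul_of_nonneg_left hax hc.le) hbx

lemma hx_iter_contr (m₁ : Measure M)
    {f : M → M} (hf : Measurable f) (hfinv : m₁.map f = m₁)
    {T : M × K → M × K} (hTf : ∀ p, (T p).1 = f p.1) {α : ℝ} (hα0 : 0 < α)
    (hTc : ∀ᵐ x ∂m₁, ∀ z₁ z₂ : K, dist (T (x, z₁)).2 (T (x, z₂)).2 ≤ α * dist z₁ z₂) (n : ℕ) :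
    ∀ᵐ x ∂m₁, ∀ z₁ z₂ : K, dist (T^[n] (x, z₁)).2 (T^[n] (x, z₂)).2 ≤ α ^ n * dist z₁ z₂ := by
  induction n with
  | zero => simp
  | succ n ih =>
    have h := ((MeasurePreserving.mk hf hfinv).iterate n).quasiMeasurePreserving.ae hTc
    filter_upwards [ih, h] with x h1 h2 z₁ z₂
    have e : ∀ z, T^[n] (x, z) = (f^[n] x, (T^[n] (x, z)).2) := fun z =>
      Prod.ext (hx_iter_fst hTf n (x, z)) rfl
    rw [Function.iterate_succ_apply', Function.iterate_succ_apply', e z₁, e z₂]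
    refine (h2 _ _).trans ?_
    rw [pow_succ', mul_assoc]
    exact mul_le_mul_of_nonneg_left (h1 z₁ z₂) hα0.le

lemma hx_real {q r D a H : ℝ} (hq0 : 0 < q) (hq1 : q < 1) (hr0 : 0 < r) (hr1 : r < 1)
    (hD : 0 < D) (ha : 0 ≤ a) (hH : 0 ≤ H) {n l m : ℕ} (hl : n ≤ 2 * l + 1) (hm : n ≤ 2 * m) :
    q ^ l * a + D * r ^ m * H ≤ ((q ^ (-(1:ℝ)/2) + D * (1 - q)⁻¹ * r ^ (-(1:ℝ)/2)) *
              (max (r ^ ((1:ℝ)/2)) (q ^ ((1:ℝ)/2))) ^ n) * (H + a) := by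
  obtain ⟨s, hs⟩ : ∃ s, s = q ^ ((1:ℝ)/2) := ⟨_, rfl⟩
  obtain ⟨t, ht⟩ : ∃ t, t = r ^ ((1:ℝ)/2) := ⟨_, rfl⟩
  have hs0 : 0 < s := hs ▸ Real.rpow_pos_of_pos hq0 _
  have ht0 : 0 < t := ht ▸ Real.rpow_pos_of_pos hr0 _
  have hs1 : s ≤ 1 := hs ▸ Real.rpow_le_one hq0.le hq1.le (by norm_num)
  have ht1 : t ≤ 1 := ht ▸ Real.rpow_le_one hr0.le hr1.le (by norm_num)
  have hs2 : q = s ^ 2 := by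
    rw [hs, ← Real.rpow_natCast, ← Real.rpow_mul hq0.le]; norm_num
  have ht2 : r = t ^ 2 := by
    rw [ht, ← Real.rpow_natCast, ← Real.rpow_mul hr0.le]; norm_num
  have hsi : q ^ (-(1:ℝ)/2) = s⁻¹ := by
    rw [hs, ← Real.rpow_neg hq0.le]; norm_num
  have hti : r ^ (-(1:ℝ)/2) = t⁻¹ := by
    rw [ht, ← Real.rpow_neg hr0.le]; norm_num
  rw [hsi, hti, ← hs, ← ht]
  have b1 : s ^ n ≤ (max t s) ^ n := pow_le_pow_left₀ hs0.le (le_max_right _ _) n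
  have b2 : t ^ n ≤ (max t s) ^ n := pow_le_pow_left₀ ht0.le (le_max_left _ _) n
  have c1 : q ^ l ≤ s⁻¹ * (max t s) ^ n := by
    rw [inv_mul_eq_div, le_div_iff₀ hs0, hs2, ← pow_mul, ← pow_succ]
    exact (pow_le_pow_of_le_one hs0.le hs1 hl).trans b1
  have c2 : r ^ m ≤ (max t s) ^ n := by
    rw [ht2, ← pow_mul]
    exact (pow_le_pow_of_le_one ht0.le ht1 hm).trans b2
  have i1 : 1 ≤ (1 - q)⁻¹ := (one_le_inv₀ (by linarith)).2 (by linarith)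
  have i2 : 1 ≤ t⁻¹ := (one_le_inv₀ ht0).2 ht1
  have i3 : D ≤ D * (1 - q)⁻¹ * t⁻¹ := by
    rw [mul_assoc]
    exact le_mul_of_one_le_right hD.le (one_le_mul_of_one_le_of_one_le i1 i2)
  have hb : 0 ≤ (max t s) ^ n := le_trans (pow_nonneg hs0.le n) b1
  have c3 : D * r ^ m ≤ D * (1 - q)⁻¹ * t⁻¹ * (max t s) ^ n :=
    mul_le_mul i3 c2 (pow_nonneg hr0.le _) (hD.le.trans i3)
  have d1 := mul_le_mul_of_nonneg_right c1 ha
  have d2 := mul_le_mul_of_nonneg_right c3 hH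
  have d3 : 0 ≤ s⁻¹ * (max t s) ^ n * H := by positivity
  have d4 : 0 ≤ D * (1 - q)⁻¹ * t⁻¹ * (max t s) ^ n * a :=
    mul_nonneg ((mul_nonneg hD.le (pow_nonneg hr0.le m)).trans c3) ha
  linarith

end Helpers

/-- **Exponential convergence to equilibrium.** With
`β₁ := max{ r^{1/2}, (α^ζ)^{1/2} }` and `D* := (α^ζ)^{-1/2} + D·(1−α^ζ)^{-1}·r^{-1/2}`, for every
signed measure `μ ∈ S^∞` with `μ(Σ) = 0` and every `n ≥ 1`:
`‖F_*^n μ‖_∞ ≤ D*·β₁^n·‖μ‖_{S^∞}`. -/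
theorem exponential_convergence_to_equilibrium {M K : Type*}
    [MetricSpace M] [CompactSpace M] [MeasurableSpace M] [BorelSpace M]
    [MetricSpace K] [CompactSpace K] [MeasurableSpace K] [BorelSpace K]
    [StandardBorelSpace K] [Nonempty K]
    (ζ : ℝ) (hζ0 : 0 < ζ) (hζ1 : ζ ≤ 1)
    (hdM : Metric.diam (Set.univ : Set M) ≤ 1) (hdK : Metric.diam (Set.univ : Set K) ≤ 1)
    (m₁ : Measure M) [IsProbabilityMeasure m₁]
    (f : M → M) (hf : Measurable f) (hfinv : m₁.map f = m₁)
    (G : M × K → K) (hG : Measurable G)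
    (α : ℝ) (hα0 : 0 < α) (hα1 : α < 1)
    (hGc : ∀ᵐ x ∂m₁, ∀ z₁ z₂ : K, dist (G (x, z₁)) (G (x, z₂)) ≤ α * dist z₁ z₂)
    (F : M × K → M × K) (hF : ∀ p, F p = (f p.1, G p))
    -- spectral gap for the transfer operator of `f`
    (D r : ℝ) (hD : 0 < D) (hr0 : 0 < r) (hr1 : r < 1)
    (hgap : ∀ φ : M → ℝ, hC ζ φ < ⊤ → ∫ x, φ x ∂m₁ = 0 → ∀ n : ℕ, 1 ≤ n →
      ∃ ψ : M → ℝ, ψ =ᵐ[m₁] (Pf m₁ f)^[n] φ ∧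
        hNormE ζ ψ ≤ ENNReal.ofReal (D * r ^ n) * hNormE ζ φ) :
    ∀ μ : SignedMeasure (M × K), memSinf ζ m₁ μ → μ Set.univ = 0 →
      ∀ n : ℕ, 1 ≤ n →
        infNormE ζ m₁ (μ.map (F^[n])) ≤
          ENNReal.ofReal (((α ^ ζ) ^ (-(1:ℝ)/2) + D * (1 - α ^ ζ)⁻¹ * r ^ (-(1:ℝ)/2)) *
              (max (r ^ ((1:ℝ)/2)) ((α ^ ζ) ^ ((1:ℝ)/2))) ^ n) *
            sNormE ζ m₁ μ := by
  intro μ hμ hμ0 n hn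
  obtain ⟨⟨hac1, hac2, hfin⟩, -⟩ := hμ
  have hac : hxAC m₁ μ := ⟨hac1, hac2⟩
  have hTf : ∀ p, (F p).1 = f p.1 := fun p => by rw [hF]
  have hFm : Measurable F := by
    have : F = fun p => (f p.1, G p) := funext hF
    rw [this]
    exact (hf.comp measurable_fst).prodMk hG
  have hTc : ∀ᵐ x ∂m₁, ∀ z₁ z₂ : K, dist (F (x, z₁)).2 (F (x, z₂)).2 ≤ α * dist z₁ z₂ := by
    filter_upwards [hGc] with x hx z₁ z₂
    rw [hF, hF]; exact hx z₁ z₂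
  have hq0 : 0 < α ^ ζ := Real.rpow_pos_of_pos hα0 _
  have hq1 : α ^ ζ < 1 := Real.rpow_lt_one hα0.le hα1 hζ0
  obtain ⟨C, hCdef⟩ : ∃ C, C = ((α ^ ζ) ^ (-(1:ℝ)/2) + D * (1 - α ^ ζ)⁻¹ * r ^ (-(1:ℝ)/2)) *
              (max (r ^ ((1:ℝ)/2)) ((α ^ ζ) ^ ((1:ℝ)/2))) ^ n := ⟨_, rfl⟩
  have hC0 : 0 < C := by
    rw [hCdef]
    have h1 : 0 < (1 - α ^ ζ)⁻¹ := inv_pos.2 (by linarith)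
    have h2 : 0 < max (r ^ ((1:ℝ)/2)) ((α ^ ζ) ^ ((1:ℝ)/2)) :=
      lt_max_of_lt_left (Real.rpow_pos_of_pos hr0 _)
    positivity
  rw [← hCdef]
  have hCE0 : ENNReal.ofReal C ≠ 0 := by simpa using hC0
  -- bound for each version of the density
  have main : ∀ φ : M → ℝ, φ =ᵐ[m₁] signedDensity m₁ μ →
      infNormE ζ m₁ (μ.map (F^[n])) ≤ ENNReal.ofReal C * (hNormE ζ φ + infNormE ζ m₁ μ) := by
    intro φ hφ
    by_cases htop : hNormE ζ φ = ⊤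
    · rw [htop, top_add, ENNReal.mul_top hCE0]; exact le_top
    have hhC : hC ζ φ < ⊤ := lt_of_le_of_lt le_add_self (lt_top_iff_ne_top.2 htop)
    have hint : ∫ x, φ x ∂m₁ = 0 := by
      rw [integral_congr_ae hφ]
      have e := hx_J_set m₁ μ hac (h := fun _ => 1) measurable_const (C := 1) (by simp)
        MeasurableSet.univ
      simp only [← hx_sd, Measure.restrict_univ, Set.univ_prod_univ, Set.indicator_univ] at e
      rw [e, sInt]
      rw [SignedMeasure.apply_eq_posPart_real_sub_negPart_real μ MeasurableSet.univ] at hμ0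
      simpa using hμ0
    obtain ⟨l, m, hlm, hm1, hl, hm⟩ : ∃ l m, l + m = n ∧ 1 ≤ m ∧ n ≤ 2 * l + 1 ∧ n ≤ 2 * m :=
      ⟨n / 2, n - n / 2, by omega, by omega, by omega, by omega⟩
    obtain ⟨ψ, hψ, hψn⟩ := hgap φ hhC hint m hm1
    have hφH : hNormE ζ φ = ENNReal.ofReal (hNormE ζ φ).toReal := (ENNReal.ofReal_toReal htop).symm
    have haH : infNormE ζ m₁ μ = ENNReal.ofReal (infNormE ζ m₁ μ).toReal :=
      (ENNReal.ofReal_toReal hfin.ne).symm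
    obtain ⟨H, hHd⟩ : ∃ H, H = (hNormE ζ φ).toReal := ⟨_, rfl⟩
    obtain ⟨a, had⟩ : ∃ a, a = (infNormE ζ m₁ μ).toReal := ⟨_, rfl⟩
    have hH0 : 0 ≤ H := hHd ▸ ENNReal.toReal_nonneg
    have ha0 : 0 ≤ a := had ▸ ENNReal.toReal_nonneg
    rw [← hHd] at hφH
    rw [← had] at haH
    have ha : ∀ᵐ γ ∂m₁, wNorm ζ (fiberS m₁ μ γ) ≤ a := by
      have h := ENNReal.ae_le_essSup (μ := m₁)
        (fun γ => ENNReal.ofReal (wNorm ζ (fiberS m₁ μ γ)))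
      filter_upwards [h] with γ h
      change _ ≤ infNormE ζ m₁ μ at h
      rw [haH] at h
      exact (ENNReal.ofReal_le_ofReal_iff ha0).1 h
    have hb : ∀ᵐ γ ∂m₁, |signedDensity m₁ (μ.map F^[m]) γ| ≤ D * r ^ m * H := by
      filter_upwards [hx_sd_iter m₁ μ hac hf hfinv hFm hTf hφ m, hψ] with γ h1 h2
      rw [h1, ← h2]
      have h3 : ENNReal.ofReal |ψ γ| ≤ hNormE ζ ψ :=
        (le_iSup (fun x => ENNReal.ofReal |ψ x|) γ).trans le_self_add
      have h4 := h3.trans hψn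
      rw [hφH, ← ENNReal.ofReal_mul (by positivity)] at h4
      exact (ENNReal.ofReal_le_ofReal_iff (by positivity)).1 h4
    have hac' : hxAC m₁ (μ.map F^[m]) := hx_AC_map m₁ μ hac (hf.iterate m)
      (hx_iter_inv hf hfinv m) (hFm.iterate m) (hx_iter_fst hTf m)
    have ha' := (hx_main hζ0 hdK m₁ μ hac (hf.iterate m) (hx_iter_inv hf hfinv m)
      (hFm.iterate m) (hx_iter_fst hTf m) (pow_pos hα0 m) (pow_le_one₀ hα0.le hα1.le)
      (hx_iter_contr m₁ hf hfinv hTf hα0 hTc m) ha).1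
    have hfinal := (hx_main hζ0 hdK m₁ (μ.map F^[m]) hac' (hf.iterate l)
      (hx_iter_inv hf hfinv l)
      (hFm.iterate l) (hx_iter_fst hTf l) (pow_pos hα0 l) (pow_le_one₀ hα0.le hα1.le)
      (hx_iter_contr m₁ hf hfinv hTf hα0 hTc l) ha').2 _ hb
    rw [hx_map_map μ (hFm.iterate m) (hFm.iterate l), ← Function.iterate_add, hlm] at hfinal
    have hpow : (α ^ l) ^ ζ = (α ^ ζ) ^ l := by
      rw [← Real.rpow_natCast, ← Real.rpow_natCast, ← Real.rpow_mul hα0.le,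
        ← Real.rpow_mul hα0.le, mul_comm]
    rw [hpow] at hfinal
    have hreal := hx_real hq0 hq1 hr0 hr1 hD ha0 hH0 hl hm
    rw [← hCdef] at hreal
    rw [hφH, haH, ← ENNReal.ofReal_add hH0 ha0, ← ENNReal.ofReal_mul hC0.le]
    refine essSup_le_of_ae_le _ ?_
    filter_upwards [hfinal] with γ h
    exact ENNReal.ofReal_le_ofReal (h.trans hreal)
  unfold sNormE
  rw [mul_comm, ← ENNReal.div_le_iff_le_mul (Or.inl hCE0) (Or.inl ENNReal.ofReal_ne_top),
    ← tsub_le_iff_right]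
  refine le_iInf₂ fun φ hφ => ?_
  rw [tsub_le_iff_right, ENNReal.div_le_iff_le_mul (Or.inl hCE0) (Or.inl ENNReal.ofReal_ne_top),
    mul_comm]
  exact main φ hφ
end

section
/- For every signed measure μ ∈ L^∞ whose marginal density φ_x := d(π_{x*}μ)/dm₁ is essentially bounded, and for every n ≥ 1: ‖F_*^n μ‖_∞ ≤ (α^ζ)^n·‖μ‖_∞ + (1/(1−α^ζ))·esssup|φ_x|. -/
open MeasureTheory ProbabilityTheory Filter ENNReal

theorem bdd_integrable_aux {X : Type*} [MeasurableSpace X] (a : Measure X) [IsFiniteMeasure a]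
    {g : X → ℝ} (hg : Measurable g) {C : ℝ} (hC : ∀ x, |g x| ≤ C) : Integrable g a :=
  Integrable.of_bound hg.aestronglyMeasurable C (Eventually.of_forall fun x => by simpa using hC x)

theorem sInt_eq_aux {X : Type*} [MeasurableSpace X] (s : SignedMeasure X) (a b : Measure X)
    [IsFiniteMeasure a] [IsFiniteMeasure b] (h : s = a.toSignedMeasure - b.toSignedMeasure)
    {g : X → ℝ} (hg : Measurable g) {C : ℝ} (hC : ∀ x, |g x| ≤ C) :
    sInt s g = ∫ x, g x ∂a - ∫ x, g x ∂b := by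
  have h1 := s.toSignedMeasure_toJordanDecomposition
  unfold JordanDecomposition.toSignedMeasure at h1
  set p := s.toJordanDecomposition.posPart with hp
  set q := s.toJordanDecomposition.negPart with hq
  have h2 : p + b = a + q := by
    rw [← Measure.toSignedMeasure_eq_toSignedMeasure_iff, Measure.toSignedMeasure_add,
      Measure.toSignedMeasure_add]
    exact sub_eq_sub_iff_add_eq_add.1 (h1.trans h)
  have h3 : ∫ x, g x ∂(p + b) = ∫ x, g x ∂(a + q) := by rw [h2]
  rw [integral_add_measure (bdd_integrable_aux _ hg hC) (bdd_integrable_aux _ hg hC),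
    integral_add_measure (bdd_integrable_aux _ hg hC) (bdd_integrable_aux _ hg hC)] at h3
  unfold sInt
  linarith

theorem fiber_disint_aux {M K : Type*} [MeasurableSpace M] [MeasurableSpace K]
    [StandardBorelSpace K] [Nonempty K] (m₁ : Measure M) [IsProbabilityMeasure m₁]
    (ρ : Measure (M × K)) [IsFiniteMeasure ρ] (hρ : ρ.fst ≪ m₁)
    {h : M × K → ℝ} (hh : Measurable h) {C : ℝ} (hC : ∀ x, |h x| ≤ C) :
    Integrable (fun γ => (ρ.fst.rnDeriv m₁ γ).toReal * ∫ z, h (γ, z) ∂(ρ.condKernel γ)) m₁ ∧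
    ∀ A : Set M, MeasurableSet A →
    ∫ γ in A, (ρ.fst.rnDeriv m₁ γ).toReal * ∫ z, h (γ, z) ∂(ρ.condKernel γ) ∂m₁ =
      ∫ p in A ×ˢ Set.univ, h p ∂ρ := by
  have hi : Integrable h (ρ.fst ⊗ₘ ρ.condKernel) := bdd_integrable_aux _ hh hC
  constructor
  · have := Integrable.integral_compProd (κ := Kernel.const Unit ρ.fst)
      (η := Kernel.prodMkLeft Unit ρ.condKernel) (a := ()) (f := h) hi
    exact (integrable_rnDeriv_smul_iff hρ).2 this
  · intro A hA
    have h1 := setIntegral_rnDeriv_smul hρ (f := fun γ => ∫ z, h (γ, z) ∂(ρ.condKernel γ)) hA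
    simp only [smul_eq_mul] at h1
    rw [h1]
    have h2 := Measure.setIntegral_compProd (μ := ρ.fst) (κ := ρ.condKernel) hA
      MeasurableSet.univ (f := h) hi.integrableOn
    simp only [Measure.restrict_univ] at h2
    rw [← h2, ρ.disintegrate]

theorem fiberS_aux {M K : Type*}
    [MetricSpace M] [CompactSpace M] [MeasurableSpace M] [BorelSpace M]
    [MetricSpace K] [CompactSpace K] [MeasurableSpace K] [BorelSpace K]
    [StandardBorelSpace K] [Nonempty K] (m₁ : Measure M) (μ : SignedMeasure (M × K)) (γ : M)
    {g : K → ℝ} (hg : Measurable g) {C : ℝ} (hC : ∀ x, |g x| ≤ C) :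
    sInt (fiberS m₁ μ γ) g =
      (μ.toJordanDecomposition.posPart.fst.rnDeriv m₁ γ).toReal *
        ∫ z, g z ∂(μ.toJordanDecomposition.posPart.condKernel γ) -
      (μ.toJordanDecomposition.negPart.fst.rnDeriv m₁ γ).toReal *
        ∫ z, g z ∂(μ.toJordanDecomposition.negPart.condKernel γ) := by
  have key : ∀ ρ : Measure (M × K), ∀ _ : IsFiniteMeasure ρ, fiberPos m₁ ρ γ =
      ((ρ.fst.rnDeriv m₁ γ).toNNReal • ρ.condKernel γ).toSignedMeasure := by
    intro ρ _
    unfold fiberPos toSM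
    rw [dif_pos (inferInstance : IsFiniteMeasure (ρ.condKernel γ)), Measure.toSignedMeasure_smul]
    rfl
  rw [sInt_eq_aux (fiberS m₁ μ γ) _ _ (by unfold fiberS; rw [key, key]) hg hC,
    integral_smul_nnreal_measure, integral_smul_nnreal_measure]
  rfl

/-- test functions -/
def tst (K : Type*) [MetricSpace K] (ζ : ℝ) : Set (K → ℝ) :=
  {g | (∀ x, |g x| ≤ 1) ∧ (∀ x y, |g x - g y| ≤ dist x y ^ ζ)}

theorem tst_cont {K : Type*} [MetricSpace K] {ζ : ℝ} (hζ : 0 < ζ) {g : K → ℝ}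
    (hg : g ∈ tst K ζ) : Continuous g := by
  rw [continuous_iff_continuousAt]
  intro x
  rw [ContinuousAt, tendsto_iff_dist_tendsto_zero]
  have h0 : Tendsto (fun y => dist y x ^ ζ) (nhds x) (nhds 0) := by
    have : Continuous fun y => dist y x ^ ζ :=
      (continuous_id.dist continuous_const).rpow_const (fun _ => Or.inr hζ.le)
    have h := this.tendsto x
    simpa [Real.zero_rpow hζ.ne'] using h
  exact squeeze_zero (fun _ => dist_nonneg) (fun y => by rw [Real.dist_eq]; exact hg.2 y x) h0

theorem sInt_bdd_aux {X : Type*} [MeasurableSpace X] (s : SignedMeasure X) {g : X → ℝ} {C : ℝ}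
    (hC : ∀ x, |g x| ≤ C) :
    |sInt s g| ≤ C * (s.toJordanDecomposition.posPart.real Set.univ +
      s.toJordanDecomposition.negPart.real Set.univ) := by
  unfold sInt
  have h1 := norm_integral_le_of_norm_le_const (μ := s.toJordanDecomposition.posPart)
    (f := g) (C := C) (Eventually.of_forall fun x => by simpa using hC x)
  have h2 := norm_integral_le_of_norm_le_const (μ := s.toJordanDecomposition.negPart)
    (f := g) (C := C) (Eventually.of_forall fun x => by simpa using hC x)
  rw [Real.norm_eq_abs] at h1 h2
  refine (abs_sub _ _).trans ?_
  linarith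

theorem le_wNorm_aux {K : Type*} [MetricSpace K] [MeasurableSpace K] {ζ : ℝ}
    (s : SignedMeasure K) {g : K → ℝ} (hg : g ∈ tst K ζ) : |sInt s g| ≤ wNorm ζ s := by
  unfold wNorm
  apply le_csSup
  · refine ⟨1 * (s.toJordanDecomposition.posPart.real Set.univ +
      s.toJordanDecomposition.negPart.real Set.univ), ?_⟩
    rintro r ⟨g, hg, -, rfl⟩
    exact sInt_bdd_aux s hg
  · exact ⟨g, hg.1, hg.2, rfl⟩

theorem wNorm_le_aux {K : Type*} [MetricSpace K] [MeasurableSpace K] {ζ : ℝ}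
    (s : SignedMeasure K) {C : ℝ} (h : ∀ g ∈ tst K ζ, |sInt s g| ≤ C) : wNorm ζ s ≤ C := by
  unfold wNorm
  apply csSup_le
  · exact ⟨_, fun _ => 0, by simp, by intro x y; simpa using Real.rpow_nonneg dist_nonneg _, rfl⟩
  · rintro r ⟨g, h1, h2, rfl⟩
    exact h g ⟨h1, h2⟩

theorem sInt_affine_aux {X : Type*} [MeasurableSpace X] (s : SignedMeasure X)
    {g : X → ℝ} (hg : Measurable g) {C : ℝ} (hC : ∀ x, |g x| ≤ C) (t c : ℝ) :
    sInt s (fun x => t * g x + c) = t * sInt s g + c * sInt s (fun _ => 1) := by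
  unfold sInt
  rw [integral_add ((bdd_integrable_aux _ hg hC).const_mul t) (integrable_const _),
    integral_add ((bdd_integrable_aux _ hg hC).const_mul t) (integrable_const _)]
  simp only [integral_const_mul, integral_const, smul_eq_mul]
  ring

theorem contr_aux {K : Type*} [MetricSpace K] [CompactSpace K] [MeasurableSpace K] [BorelSpace K]
    [Nonempty K] {ζ : ℝ} (hζ : 0 < ζ) (hdK : Metric.diam (Set.univ : Set K) ≤ 1)
    (s : SignedMeasure K) {β : ℝ} (hβ : 0 < β) {h : K → K} (hm : Measurable h)
    (hc : ∀ z₁ z₂, dist (h z₁) (h z₂) ≤ β * dist z₁ z₂) {g : K → ℝ} (hg : g ∈ tst K ζ) :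
    |sInt s (fun z => g (h z))| ≤ β ^ ζ * wNorm ζ s + |sInt s (fun _ => 1)| := by
  obtain ⟨z₀⟩ := ‹Nonempty K›
  have hb : 0 < β ^ ζ := Real.rpow_pos_of_pos hβ _
  have hd : ∀ x y : K, dist x y ≤ 1 := fun x y =>
    (Metric.dist_le_diam_of_mem isCompact_univ.isBounded (Set.mem_univ _) (Set.mem_univ _)).trans hdK
  set ψ : K → ℝ := fun z => (β ^ ζ)⁻¹ * (g (h z) - g (h z₀)) with hψ
  have hH : ∀ x y, |g (h x) - g (h y)| ≤ β ^ ζ * dist x y ^ ζ := by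
    intro x y
    refine (hg.2 _ _).trans ?_
    rw [← Real.mul_rpow hβ.le dist_nonneg]
    exact Real.rpow_le_rpow dist_nonneg (hc _ _) hζ.le
  have hψt : ψ ∈ tst K ζ := by
    constructor
    · intro x
      rw [hψ, abs_mul, abs_of_pos (inv_pos.2 hb), inv_mul_le_iff₀ hb]
      refine (hH _ _).trans ?_
      gcongr
      exact Real.rpow_le_one dist_nonneg (hd _ _) hζ.le
    · intro x y
      have : ψ x - ψ y = (β ^ ζ)⁻¹ * (g (h x) - g (h y)) := by simp only [hψ]; ring
      rw [this, abs_mul, abs_of_pos (inv_pos.2 hb), inv_mul_le_iff₀ hb]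
      exact hH _ _
  have e : (fun z => g (h z)) = fun z => β ^ ζ * ψ z + g (h z₀) := by
    funext z
    simp only [hψ]
    rw [mul_inv_cancel_left₀ hb.ne']; ring
  rw [e, sInt_affine_aux s (tst_cont hζ hψt).measurable hψt.1]
  refine (abs_add_le _ _).trans ?_
  rw [abs_mul, abs_mul, abs_of_pos hb]
  have h1 := le_wNorm_aux s hψt
  have h2 := hg.1 (h z₀)
  have h3 := abs_nonneg (sInt s (fun _ => (1:ℝ)))
  gcongr
  nlinarith

theorem single_aux {M K : Type*}
    [MetricSpace M] [CompactSpace M] [MeasurableSpace M] [BorelSpace M]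
    [MetricSpace K] [CompactSpace K] [MeasurableSpace K] [BorelSpace K]
    [StandardBorelSpace K] [Nonempty K]
    (m₁ : Measure M) [IsProbabilityMeasure m₁]
    (f : M → M) (hf : Measurable f) (hfinv : m₁.map f = m₁)
    (H : M × K → K) (hH : Measurable H)
    (μ : SignedMeasure (M × K))
    (hp : μ.toJordanDecomposition.posPart.fst ≪ m₁)
    (hn : μ.toJordanDecomposition.negPart.fst ≪ m₁)
    {g : K → ℝ} (hg : Measurable g) (hg1 : ∀ x, |g x| ≤ 1) {C : ℝ}
    (hC : ∀ᵐ x ∂m₁, |sInt (fiberS m₁ μ x) (fun z => g (H (x, z)))| ≤ C) :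
    ∀ᵐ γ ∂m₁, |sInt (fiberS m₁ (μ.map (fun p => (f p.1, H p))) γ) g| ≤ C := by
  set Φ : M × K → M × K := fun p => (f p.1, H p) with hΦ
  have hΦm : Measurable Φ := (hf.comp measurable_fst).prodMk hH
  set ν : SignedMeasure (M × K) := μ.map Φ with hν
  set a := μ.toJordanDecomposition.posPart with ha
  set b := μ.toJordanDecomposition.negPart with hb
  have hμ : μ = a.toSignedMeasure - b.toSignedMeasure :=
    μ.toSignedMeasure_toJordanDecomposition.symm
  have hνab : ν = (a.map Φ).toSignedMeasure - (b.map Φ).toSignedMeasure := by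
    ext E hE
    rw [hν, VectorMeasure.map_apply _ hΦm hE, _root_.sub_apply,
      Measure.toSignedMeasure_apply_measurable hE, Measure.toSignedMeasure_apply_measurable hE,
      map_measureReal_apply hΦm hE, map_measureReal_apply hΦm hE]
    conv_lhs => rw [hμ]
    rw [_root_.sub_apply,
      Measure.toSignedMeasure_apply_measurable (hΦm hE),
      Measure.toSignedMeasure_apply_measurable (hΦm hE)]
  -- absolute continuity
  have hac : ∀ A : Set M, MeasurableSet A → m₁ A = 0 →
      (a.map Φ) (Prod.fst ⁻¹' A) = 0 ∧ (b.map Φ) (Prod.fst ⁻¹' A) = 0 := by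
    intro A hA hA0
    have hfA : m₁ (f ⁻¹' A) = 0 := by rw [← Measure.map_apply hf hA, hfinv, hA0]
    have e1 := hp hfA
    have e2 := hn hfA
    rw [Measure.fst_apply (hf hA)] at e1 e2
    rw [Measure.map_apply hΦm (measurable_fst hA), Measure.map_apply hΦm (measurable_fst hA)]
    exact ⟨e1, e2⟩
  have hνac : ν ≪ᵥ (a.map Φ + b.map Φ).toENNRealVectorMeasure := by
    refine VectorMeasure.AbsolutelyContinuous.mk fun E hE h0 => ?_
    rw [Measure.toENNRealVectorMeasure_apply_measurable hE, Measure.add_apply] at h0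
    obtain ⟨h1, h2⟩ := add_eq_zero.1 h0
    rw [hνab, _root_.sub_apply,
      Measure.toSignedMeasure_apply_measurable hE, Measure.toSignedMeasure_apply_measurable hE]
    simp [measureReal_def, h1, h2]
  rw [SignedMeasure.absolutelyContinuous_ennreal_iff] at hνac
  have hTV : ∀ A : Set M, MeasurableSet A → m₁ A = 0 →
      ν.totalVariation (Prod.fst ⁻¹' A) = 0 := by
    intro A hA h0
    apply hνac
    obtain ⟨h1, h2⟩ := hac A hA h0
    have : (VectorMeasure.ennrealToMeasure (a.map Φ + b.map Φ).toENNRealVectorMeasure)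
        = a.map Φ + b.map Φ := by
      exact VectorMeasure.ennrealToMeasure_toENNRealVectorMeasure _
    rw [this, Measure.add_apply, h1, h2, add_zero]
  have hνp : ν.toJordanDecomposition.posPart.fst ≪ m₁ := by
    refine Measure.AbsolutelyContinuous.mk fun A hA h0 => ?_
    have := hTV A hA h0
    rw [SignedMeasure.totalVariation, Measure.add_apply] at this
    rw [Measure.fst_apply hA]
    exact (add_eq_zero.1 this).1
  have hνn : ν.toJordanDecomposition.negPart.fst ≪ m₁ := by
    refine Measure.AbsolutelyContinuous.mk fun A hA h0 => ?_
    have := hTV A hA h0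
    rw [SignedMeasure.totalVariation, Measure.add_apply] at this
    rw [Measure.fst_apply hA]
    exact (add_eq_zero.1 this).2
  have hgs : Measurable fun p : M × K => g p.2 := hg.comp measurable_snd
  have hgH : Measurable fun p : M × K => g (H p) := hg.comp hH
  obtain ⟨i1, d1⟩ := fiber_disint_aux m₁ _ hνp hgs (C := 1) (fun p => hg1 _)
  obtain ⟨i2, d2⟩ := fiber_disint_aux m₁ _ hνn hgs (C := 1) (fun p => hg1 _)
  obtain ⟨i3, d3⟩ := fiber_disint_aux m₁ _ hp hgH (C := 1) (fun p => hg1 _)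
  obtain ⟨i4, d4⟩ := fiber_disint_aux m₁ _ hn hgH (C := 1) (fun p => hg1 _)
  have eu : (fun γ => sInt (fiberS m₁ ν γ) g) = _ :=
    funext fun γ => fiberS_aux m₁ ν γ hg hg1
  have ev : (fun x => sInt (fiberS m₁ μ x) (fun z => g (H (x, z)))) = _ :=
    funext fun γ => fiberS_aux m₁ μ γ (g := fun z => g (H (γ, z)))
      (hg.comp (hH.comp measurable_prodMk_left)) (fun z => hg1 _)
  have hui : Integrable (fun γ => sInt (fiberS m₁ ν γ) g) m₁ := by
    rw [eu]; exact i1.sub i2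
  have key : ∀ A : Set M, MeasurableSet A → ∫ γ in A, sInt (fiberS m₁ ν γ) g ∂m₁ =
      ∫ x in f ⁻¹' A, sInt (fiberS m₁ μ x) (fun z => g (H (x, z))) ∂m₁ := by
    intro A hA
    rw [eu, ev, integral_sub i1.integrableOn i2.integrableOn,
      integral_sub i3.integrableOn i4.integrableOn, d1 A hA, d2 A hA, d3 _ (hf hA), d4 _ (hf hA)]
    have hE : MeasurableSet (A ×ˢ (Set.univ : Set K)) := hA.prod MeasurableSet.univ
    have hq := sInt_eq_aux ν _ _ hνab (g := (A ×ˢ (Set.univ : Set K)).indicator fun p => g p.2)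
      (hgs.indicator hE) (C := 1) (by
        intro p
        by_cases h : p ∈ A ×ˢ (Set.univ : Set K)
        · rw [Set.indicator_of_mem h]; exact hg1 _
        · rw [Set.indicator_of_notMem h]; simp)
    unfold sInt at hq
    rw [integral_indicator hE, integral_indicator hE, integral_indicator hE,
      integral_indicator hE] at hq
    rw [hq, setIntegral_map hE hgs.aestronglyMeasurable hΦm.aemeasurable,
      setIntegral_map hE hgs.aestronglyMeasurable hΦm.aemeasurable]
    have : Φ ⁻¹' (A ×ˢ (Set.univ : Set K)) = (f ⁻¹' A) ×ˢ Set.univ := by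
      ext p; simp [hΦ]
    rw [this]
  have hbd : ∀ A : Set M, MeasurableSet A →
      |∫ γ in A, sInt (fiberS m₁ ν γ) g ∂m₁| ≤ C * m₁.real A := by
    intro A hA
    rw [key A hA]
    have := norm_setIntegral_le_of_norm_le_const_ae' (μ := m₁) (s := f ⁻¹' A) (C := C)
      (f := fun x => sInt (fiberS m₁ μ x) (fun z => g (H (x, z)))) (measure_lt_top _ _)
      (by filter_upwards [hC] with x hx _ using hx)
    rwa [Real.norm_eq_abs, ← map_measureReal_apply hf hA, hfinv] at this
  have l1 : (fun γ => sInt (fiberS m₁ ν γ) g) ≤ᵐ[m₁] fun _ => C := by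
    refine ae_le_of_forall_setIntegral_le hui (integrable_const _) fun A hA _ => ?_
    rw [setIntegral_const, smul_eq_mul, mul_comm]
    exact (le_abs_self _).trans (hbd A hA)
  have l2 : (fun _ => -C) ≤ᵐ[m₁] (fun γ => sInt (fiberS m₁ ν γ) g) := by
    refine ae_le_of_forall_setIntegral_le (integrable_const _) hui fun A hA _ => ?_
    rw [setIntegral_const, smul_eq_mul]
    have := (abs_le.1 (hbd A hA)).1
    linarith
  filter_upwards [l1, l2] with γ h1 h2 using abs_le.2 ⟨h2, h1⟩

theorem wNorm_ae_aux {M K : Type*} [MeasurableSpace M]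
    [MetricSpace K] [CompactSpace K] [MeasurableSpace K] [BorelSpace K]
    (m₁ : Measure M) {ζ : ℝ} (hζ : 0 < ζ) (S : M → SignedMeasure K) {C : ℝ}
    (h : ∀ g ∈ tst K ζ, ∀ᵐ γ ∂m₁, |sInt (S γ) g| ≤ C) :
    ∀ᵐ γ ∂m₁, wNorm ζ (S γ) ≤ C := by
  let T : Set C(K, ℝ) := {g | (g : K → ℝ) ∈ tst K ζ}
  obtain ⟨D, hDc, hDd⟩ := TopologicalSpace.exists_countable_dense T
  have h1 : ∀ᵐ γ ∂m₁, ∀ g ∈ D, |sInt (S γ) (g : C(K, ℝ))| ≤ C :=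
    (ae_ball_iff hDc).2 fun g _ => h _ g.2
  filter_upwards [h1] with γ hγ
  refine wNorm_le_aux _ fun g hg => ?_
  have hcont : ∀ a : Measure K, ∀ _ : IsFiniteMeasure a,
      Continuous fun g : C(K, ℝ) => ∫ x, g x ∂a := by
    intro a _
    refine continuous_iff_continuousAt.2 fun g₀ => ?_
    rw [ContinuousAt, tendsto_iff_dist_tendsto_zero]
    have h0 : Tendsto (fun g : C(K, ℝ) => dist g g₀ * a.real Set.univ) (nhds g₀) (nhds 0) := by
      have : Continuous fun g : C(K, ℝ) => dist g g₀ * a.real Set.univ := by fun_prop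
      simpa using this.tendsto g₀
    refine squeeze_zero (fun _ => dist_nonneg) (fun g => ?_) h0
    have hi : ∀ g : C(K, ℝ), Integrable (fun x => g x) a := fun g =>
      bdd_integrable_aux a g.continuous.measurable (C := ‖g‖) fun x => g.norm_coe_le_norm x
    rw [dist_eq_norm, ← integral_sub (hi _) (hi _)]
    refine norm_integral_le_of_norm_le_const (Eventually.of_forall fun x => ?_)
    rw [← dist_eq_norm]
    exact ContinuousMap.dist_apply_le_dist x
  have hc : Continuous fun g : T => |sInt (S γ) (g : C(K, ℝ))| := by
    unfold sInt
    exact (((hcont _ inferInstance).sub (hcont _ inferInstance)).abs).comp continuous_subtype_val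
  have hcl : IsClosed {g : T | |sInt (S γ) (g : C(K, ℝ))| ≤ C} :=
    isClosed_le hc continuous_const
  have := hcl.closure_subset_iff.2 (show D ⊆ _ from fun g hg => hγ g hg)
  exact this (hDd ⟨⟨g, tst_cont hζ hg⟩, hg⟩)

/-- For every signed measure `μ ∈ L^∞` whose marginal density
`φ_x = d(π_{x*}μ)/dm₁` is essentially bounded (by any essential bound `B`), and every `n ≥ 1`:
`‖F_*^n μ‖_∞ ≤ (α^ζ)^n·‖μ‖_∞ + (1/(1−α^ζ))·esssup|φ_x|`. -/
theorem infNorm_iterate_le {M K : Type*}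
    [MetricSpace M] [CompactSpace M] [MeasurableSpace M] [BorelSpace M]
    [MetricSpace K] [CompactSpace K] [MeasurableSpace K] [BorelSpace K]
    [StandardBorelSpace K] [Nonempty K]
    (ζ : ℝ) (hζ0 : 0 < ζ) (hζ1 : ζ ≤ 1)
    (hdM : Metric.diam (Set.univ : Set M) ≤ 1) (hdK : Metric.diam (Set.univ : Set K) ≤ 1)
    (m₁ : Measure M) [IsProbabilityMeasure m₁]
    (f : M → M) (hf : Measurable f) (hfinv : m₁.map f = m₁)
    (G : M × K → K) (hG : Measurable G)
    (α : ℝ) (hα0 : 0 < α) (hα1 : α < 1)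
    (hGc : ∀ᵐ x ∂m₁, ∀ z₁ z₂ : K, dist (G (x, z₁)) (G (x, z₂)) ≤ α * dist z₁ z₂)
    (F : M × K → M × K) (hF : ∀ p, F p = (f p.1, G p)) :
    ∀ μ : SignedMeasure (M × K), memLinf ζ m₁ μ →
      ∀ B : ℝ, 0 ≤ B → (∀ᵐ γ ∂m₁, |signedDensity m₁ μ γ| ≤ B) →
        ∀ n : ℕ, 1 ≤ n →
          infNormE ζ m₁ (μ.map (F^[n])) ≤
            ENNReal.ofReal ((α ^ ζ) ^ n) * infNormE ζ m₁ μ +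
              ENNReal.ofReal ((1 / (1 - α ^ ζ)) * B) := by
  intro μ hμ B hB0 hB n hn
  obtain ⟨hp, hq, hfin⟩ := hμ
  have hFm : Measurable F := by
    have : F = fun p => (f p.1, G p) := funext hF
    rw [this]
    exact (hf.comp measurable_fst).prodMk hG
  set H : M × K → K := fun p => (F^[n] p).2 with hH
  have hHm : Measurable H := measurable_snd.comp (hFm.iterate n)
  have hmp : MeasurePreserving f m₁ m₁ := ⟨hf, hfinv⟩
  have hFst : ∀ k p, (F^[k] p).1 = f^[k] p.1 := by
    intro k
    induction k with
    | zero => intro p; rfl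
    | succ k ih => intro p; rw [Function.iterate_succ_apply', hF, Function.iterate_succ_apply', ih]
  have hFn : F^[n] = fun p => (f^[n] p.1, H p) := by
    funext p
    exact Prod.ext (hFst n p) rfl
  have hcon : ∀ᵐ x ∂m₁, ∀ z₁ z₂ : K, dist (H (x, z₁)) (H (x, z₂)) ≤ α ^ n * dist z₁ z₂ := by
    have h1 : ∀ᵐ x ∂m₁, ∀ k, ∀ z₁ z₂ : K,
        dist (G (f^[k] x, z₁)) (G (f^[k] x, z₂)) ≤ α * dist z₁ z₂ :=
      ae_all_iff.2 fun k => (hmp.iterate k).quasiMeasurePreserving.ae hGc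
    filter_upwards [h1] with x hx z₁ z₂
    have : ∀ k, dist (F^[k] (x, z₁)).2 (F^[k] (x, z₂)).2 ≤ α ^ k * dist z₁ z₂ := by
      intro k
      induction k with
      | zero => simp
      | succ k ih =>
        rw [Function.iterate_succ_apply', Function.iterate_succ_apply', hF, hF]
        have e : ∀ z, F^[k] (x, z) = (f^[k] x, (F^[k] (x, z)).2) := fun z =>
          Prod.ext (hFst k _) rfl
        have h2 := hx k (F^[k] (x, z₁)).2 (F^[k] (x, z₂)).2
        rw [← e, ← e] at h2
        refine h2.trans ?_
        rw [pow_succ']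
        nlinarith
    exact this n
  set W := (infNormE ζ m₁ μ).toReal with hW
  have hWae : ∀ᵐ x ∂m₁, wNorm ζ (fiberS m₁ μ x) ≤ W := by
    filter_upwards [ENNReal.ae_le_essSup
      (fun γ => ENNReal.ofReal (wNorm ζ (fiberS m₁ μ γ)))] with x hx
    exact (ENNReal.ofReal_le_iff_le_toReal hfin.ne).1 hx
  have hpow : (α ^ n) ^ ζ = (α ^ ζ) ^ n := by
    rw [← Real.rpow_natCast, ← Real.rpow_natCast, ← Real.rpow_mul hα0.le, ← Real.rpow_mul hα0.le,
      mul_comm]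
  have hnn : 0 ≤ (α ^ ζ) ^ n := pow_nonneg (Real.rpow_nonneg hα0.le _) _
  have main : ∀ᵐ γ ∂m₁, wNorm ζ (fiberS m₁ (μ.map (F^[n])) γ) ≤ (α ^ ζ) ^ n * W + B := by
    refine wNorm_ae_aux m₁ hζ0 _ fun g hg => ?_
    rw [hFn]
    refine single_aux m₁ (f^[n]) (hf.iterate n) (hmp.iterate n).map_eq H hHm μ hp hq
      (tst_cont hζ0 hg).measurable hg.1 ?_
    filter_upwards [hcon, hWae, hB] with x h1 h2 h3
    refine (contr_aux hζ0 hdK (fiberS m₁ μ x) (pow_pos hα0 n) (h := fun z => H (x, z))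
      (hHm.comp measurable_prodMk_left) h1 hg).trans ?_
    have e : sInt (fiberS m₁ μ x) (fun _ => 1) = signedDensity m₁ μ x := by
      rw [fiberS_aux m₁ μ x measurable_const (C := 1) (by simp)]
      simp [signedDensity]
    rw [e, hpow]
    gcongr
  have hlt : α ^ ζ < 1 := Real.rpow_lt_one hα0.le hα1 hζ0
  have hpos : 0 < α ^ ζ := Real.rpow_pos_of_pos hα0 _
  have hB' : B ≤ 1 / (1 - α ^ ζ) * B := by
    have : 1 ≤ 1 / (1 - α ^ ζ) := by
      rw [le_div_iff₀ (by linarith)]; linarith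
    nlinarith
  refine essSup_le_of_ae_le _ ?_
  filter_upwards [main] with γ hγ
  calc ENNReal.ofReal (wNorm ζ (fiberS m₁ (μ.map (F^[n])) γ))
      ≤ ENNReal.ofReal ((α ^ ζ) ^ n * W + 1 / (1 - α ^ ζ) * B) :=
        ENNReal.ofReal_le_ofReal (by linarith)
    _ = _ := by
        rw [ENNReal.ofReal_add (mul_nonneg hnn ENNReal.toReal_nonneg) (hB0.trans hB'),
          ENNReal.ofReal_mul hnn, ENNReal.ofReal_toReal hfin.ne]
end
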